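/- arXiv:2306.12035 — 3 statements merged into one kernel-verified Lean document; each statement's English description precedes it below -/
import Mathlib

section
/- If M is a maximal modular subgroup of a finite group G, then either M is normal in G and G/M is simple, or G/M_G is a non-abelian group of order pq for distinct primes p and q. -/
universe u

/-- A class of groups is subgroup-closed if it is closed under taking subgroups. -/
def IsSubgroupClosed (F : ∀ (G : Type u) [Group G], Prop) : Prop :=
  ∀ (G : Type u) [Group G] (H : Subgroup G), F G → F H

/-- A formation: a class of groups closed under isomorphisms, quotients and
subdirect products. -/
structure IsFormation (F : ∀ (G : Type u) [Group G], Prop) : Prop where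
  iso : ∀ (G H : Type u) [Group G] [Group H], G ≃* H → F G → F H
  quot : ∀ (G : Type u) [Group G] (N : Subgroup G) (_ : N.Normal), F G → F (G ⧸ N)
  subdirect : ∀ (G : Type u) [Group G] (N₁ N₂ : Subgroup G) (_ : N₁.Normal) (_ : N₂.Normal),
    F (G ⧸ N₁) → F (G ⧸ N₂) → N₁ ⊓ N₂ = ⊥ → F G

/-- The 𝔉-fResidual of `G`: the smallest normal subgroup with quotient in `F`. -/
def fResidual (F : ∀ (G : Type u) [Group G], Prop) (G : Type u) [Group G] : Subgroup G :=
  sInf {N : Subgroup G | ∃ _ : N.Normal, F (G ⧸ N)}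

/-- `KSubnormal F H K` : there is a chain `H = H₀ ≤ … ≤ Hₙ = K` of subgroups of `G`
such that each `Hᵢ` is normal in `Hᵢ₊₁` or contains the `F`-fResidual of `Hᵢ₊₁`. -/
inductive KSubnormal (F : ∀ (G : Type u) [Group G], Prop) {G : Type u} [Group G] :
    Subgroup G → Subgroup G → Prop
  | refl (H : Subgroup G) : KSubnormal F H H
  | step {H K L : Subgroup G} : KSubnormal F H K → K ≤ L →
      ((K.subgroupOf L).Normal ∨ fResidual F ↥L ≤ K.subgroupOf L) → KSubnormal F H L

/-- `M` is a modular element of the subgroup lattice of `G`. -/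
def IsModularSubgroup {G : Type u} [Group G] (M : Subgroup G) : Prop :=
  (∀ X Y : Subgroup G, X ≤ Y → (X ⊔ M) ⊓ Y = X ⊔ (M ⊓ Y)) ∧
  (∀ X Y : Subgroup G, M ≤ Y → (M ⊔ X) ⊓ Y = M ⊔ (X ⊓ Y))

/-- `Submodular H K` : a chain from `H` to `K` with each term modular in the next. -/
inductive Submodular {G : Type u} [Group G] : Subgroup G → Subgroup G → Prop
  | refl (H : Subgroup G) : Submodular H H
  | step {H K L : Subgroup G} : Submodular H K → K ≤ L →
      IsModularSubgroup (K.subgroupOf L) → Submodular H L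

/-- `SubnormalIn H K` : a chain from `H` to `K` with each term normal in the next. -/
inductive SubnormalIn {G : Type u} [Group G] : Subgroup G → Subgroup G → Prop
  | refl (H : Subgroup G) : SubnormalIn H H
  | step {H K L : Subgroup G} : SubnormalIn H K → K ≤ L →
      (K.subgroupOf L).Normal → SubnormalIn H L

/-- A group is supersolvable if it has a normal series with cyclic factors:
each term is normal in `G` and each successive term is generated by the previous
one together with a single element. -/
def IsSupersolvable (G : Type u) [Group G] : Prop :=
  ∃ (n : ℕ) (s : Fin (n + 1) → Subgroup G), s 0 = ⊥ ∧ s (Fin.last n) = ⊤ ∧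
    (∀ i, (s i).Normal) ∧
    ∀ i : Fin n, ∃ g : G, s i.succ = s i.castSucc ⊔ Subgroup.zpowers g

/-- The class 𝔘₁ of supersolvable groups of square-free exponent. -/
def U1 : ∀ (G : Type u) [Group G], Prop := fun G _ =>
  IsSupersolvable G ∧ Squarefree (Monoid.exponent G)

/-- The solvable radical: the largest normal solvable subgroup. -/
def solvRad (G : Type u) [Group G] : Subgroup G :=
  sSup {N : Subgroup G | N.Normal ∧ IsSolvable ↥N}

/-- The Fitting subgroup: the largest normal nilpotent subgroup. -/
def fitting (G : Type u) [Group G] : Subgroup G :=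
  sSup {N : Subgroup G | N.Normal ∧ Group.IsNilpotent ↥N}

theorem IsModularSubgroup.sup' {G : Type u} [Group G] {a b : Subgroup G}
    (ha : IsModularSubgroup a) (hb : IsModularSubgroup b) : IsModularSubgroup (a ⊔ b) := by
  constructor
  · intro x y hxy
    apply le_antisymm
    · set x' := x ⊔ ((a ⊔ b) ⊓ y) with hx'
      have hx'y : x' ≤ y := sup_le hxy inf_le_right
      have h1 : (a ⊔ y) ⊓ b ≤ x' ⊔ a := by
        have := ha.2 y (a ⊔ b) le_sup_left
        calc (a ⊔ y) ⊓ b ≤ (a ⊔ y) ⊓ (a ⊔ b) := inf_le_inf_left _ le_sup_right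
          _ = a ⊔ (y ⊓ (a ⊔ b)) := this
          _ ≤ x' ⊔ a := by
            rw [inf_comm y]
            exact sup_le le_sup_right ((le_sup_right).trans le_sup_left)
      have h2 := hb.1 (x' ⊔ a) (a ⊔ y) (sup_le (hx'y.trans le_sup_right) le_sup_left)
      have h3 : x' ⊔ a ⊔ (b ⊓ (a ⊔ y)) = x' ⊔ a := by
        rw [inf_comm b]; exact sup_eq_left.2 h1
      have h4 := ha.1 x' y hx'y
      have h5 : a ⊓ y ≤ x' := le_sup_of_le_right (inf_le_inf_right _ le_sup_left)
      calc (x ⊔ (a ⊔ b)) ⊓ y ≤ ((x' ⊔ a ⊔ b) ⊓ (a ⊔ y)) ⊓ y := by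
            refine le_inf (le_inf (inf_le_left.trans ?_) (inf_le_right.trans le_sup_right)) inf_le_right
            rw [sup_assoc]
            exact sup_le_sup_right le_sup_left _
        _ = (x' ⊔ a) ⊓ y := by rw [h2, h3]
        _ = x' := by rw [h4, sup_eq_left.2 h5]
        _ ≤ x' := le_rfl
    · exact sup_le (le_inf le_sup_left hxy) (inf_le_inf_right _ le_sup_right)
  · intro x y hy
    have h1 := ha.2 (b ⊔ x) y (le_sup_left.trans hy)
    have h2 := hb.2 x y (le_sup_right.trans hy)
    rw [sup_assoc, h1, h2, sup_assoc]

theorem IsModularSubgroup.mapEquiv {G : Type u} [Group G] {a : Subgroup G}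
    (ha : IsModularSubgroup a) (f : Subgroup G ≃o Subgroup G) : IsModularSubgroup (f a) := by
  constructor
  · intro x y hxy
    have := congrArg f (ha.1 (f.symm x) (f.symm y) (f.symm.monotone hxy))
    simpa using this
  · intro x y hxy
    have := congrArg f (ha.2 (f.symm x) (f.symm y) (by rw [f.le_symm_apply]; exact hxy))
    simpa using this

/-- every intersection `Y ⊓ M` is `Y` or maximal in `Y` -/
def MaxInt {G : Type*} [Group G] (M : Subgroup G) : Prop :=
  ∀ X Y : Subgroup G, Y ⊓ M ≤ X → X ≤ Y → ¬ X ≤ M → X = Y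

theorem MaxInt.comap {G H : Type*} [Group G] [Group H] {M : Subgroup G} (h : MaxInt M)
    (f : H →* G) (hf : Function.Injective f) : MaxInt (M.comap f) := by
  intro X Y h1 h2 h3
  apply Subgroup.map_injective hf
  apply h
  · rintro _ ⟨⟨y, hy, rfl⟩, hm⟩
    exact ⟨y, h1 ⟨hy, hm⟩, rfl⟩
  · exact Subgroup.map_mono h2
  · rwa [Subgroup.map_le_iff_le_comap]

theorem MaxInt.map {G H : Type*} [Group G] [Group H] {M : Subgroup G} (h : MaxInt M)
    (f : G →* H) (hf : Function.Surjective f) : MaxInt (M.map f) := by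
  intro X Y h1 h2 h3
  apply Subgroup.comap_injective hf
  apply h
  · rintro y ⟨hy, hm⟩
    exact h1 ⟨hy, ⟨y, hm, rfl⟩⟩
  · exact Subgroup.comap_mono h2
  · intro h4
    apply h3
    intro x hx
    obtain ⟨g, rfl⟩ := hf x
    exact ⟨g, h4 hx, rfl⟩

theorem maximal_of_nonnormal {G : Type u} [Group G] [Finite G] {M : Subgroup G}
    (hmod : IsModularSubgroup M)
    (hmax : ∀ K : Subgroup G, M < K → K < ⊤ → ¬ IsModularSubgroup K) (hn : ¬ M.Normal) :
    ∀ K : Subgroup G, M ≤ K → K ≠ ⊤ → K = M := by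
  have h1 : ∀ K : Subgroup G, M ≤ K → K ≠ ⊤ → K ≤ Subgroup.normalizer (M : Set G) := by
    intro K hMK hK z hz
    have hm2 := hmod.sup' (hmod.mapEquiv (MulAut.conj z).mapSubgroup)
    set M' := (MulAut.conj z).mapSubgroup M with hM'
    have hM'K : M' ≤ K := by
      rintro _ ⟨m, hm, rfl⟩
      exact K.mul_mem (K.mul_mem hz (hMK hm)) (K.inv_mem hz)
    have hle : M' ≤ M := by
      by_contra hcon
      refine hmax (M ⊔ M') ?_ ?_ hm2
      · exact left_lt_sup.2 hcon
      · exact lt_of_le_of_lt (sup_le hMK hM'K) (lt_top_iff_ne_top.2 hK)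
    rw [Subgroup.mem_normalizer_iff_map_conj_eq]
    apply Subgroup.eq_of_le_of_card_ge hle
    rw [hM']
    exact (Subgroup.card_mapSubgroup _ _).ge
  have hNtop : Subgroup.normalizer (M : Set G) ≠ ⊤ := fun h =>
    hn (Subgroup.normalizer_eq_top_iff.1 h)
  have hNM : Subgroup.normalizer (M : Set G) = M := by
    by_contra hne
    have hMN : M ≤ Subgroup.normalizer (M : Set G) := Subgroup.le_normalizer
    refine hmax _ (lt_of_le_of_ne hMN (Ne.symm hne)) (lt_top_iff_ne_top.2 hNtop) ?_
    set N := Subgroup.normalizer (M : Set G)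
    constructor
    · intro X Y hXY
      by_cases hX : X ≤ N
      · rw [sup_eq_right.2 hX, sup_eq_right.2 (le_inf hX hXY)]
      · have : X ⊔ M = ⊤ := by
          by_contra hc
          exact hX (le_sup_left.trans (h1 _ le_sup_right hc))
        have h2 := hmod.1 X Y hXY
        rw [this, top_inf_eq] at h2
        apply le_antisymm
        · refine inf_le_right.trans ?_
          conv_lhs => rw [h2]
          exact sup_le_sup_left (inf_le_inf_right _ hMN) _
        · exact sup_le (le_inf le_sup_left hXY) (inf_le_inf_right _ le_sup_right)
    · intro X Y hNY
      by_cases hY : Y = ⊤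
      · simp [hY]
      · have : Y = N := le_antisymm (h1 Y (hMN.trans hNY) hY) hNY
        rw [this, inf_eq_right.2 le_sup_left, sup_eq_left.2 inf_le_right]
  intro K hMK hK
  exact le_antisymm (hNM ▸ h1 K hMK hK) hMK

theorem prime_card_of {G : Type*} [Group G] [Finite G] (H : Subgroup G) (hH : H ≠ ⊥)
    (h : ∀ X ≤ H, X ≠ ⊥ → X = H) : (Nat.card H).Prime := by
  have h1 : Nat.card H ≠ 1 := fun h => hH (Subgroup.card_eq_one.1 h)
  have := Fact.mk (Nat.minFac_prime h1)
  obtain ⟨x, hx⟩ := exists_prime_orderOf_dvd_card' (G := H) _ (Nat.minFac_dvd (Nat.card H))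
  have hx2 : orderOf (x : G) = (Nat.card H).minFac := by rw [Subgroup.orderOf_coe, hx]
  have := h (Subgroup.zpowers (x : G)) (by simp) (by
    intro h
    rw [Subgroup.zpowers_eq_bot] at h
    rw [h, orderOf_one] at hx2
    exact (Nat.minFac_prime h1).one_lt.ne hx2)
  rw [← this, Nat.card_zpowers, hx2]
  exact Nat.minFac_prime h1

theorem pgroup_step {G : Type*} [Group G] [Finite G] {p : ℕ} [Fact p.Prime]
    (hp : ∀ q : ℕ, q.Prime → q ∣ Nat.card G → p ≤ q) (P : Subgroup G) (hP : IsPGroup p P)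
    (M : Subgroup G) (hM : MaxInt M) (hPM : ¬ P ≤ M) :
    (∀ a ∈ P, ∀ b ∈ P, a * b * a⁻¹ * b⁻¹ ∈ M) ∧
    (∀ m ∈ M, m ∈ Subgroup.normalizer (P : Set G) → ∀ u ∈ P, m * u * m⁻¹ * u⁻¹ ∈ M) := by
  have hR : MaxInt (M.subgroupOf P) := hM.comap P.subtype P.subtype_injective
  set R := M.subgroupOf P with hRdef
  have hRtop : R ≠ ⊤ := fun h => hPM (Subgroup.subgroupOf_eq_top.1 h)
  have hco : IsCoatom R := by
    refine ⟨hRtop, fun X hX => ?_⟩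
    exact hR X ⊤ (by simpa using hX.le) le_top hX.not_ge
  have : Group.IsNilpotent P := hP.isNilpotent
  have hRn : R.Normal := Subgroup.NormalizerCondition.normal_of_coatom _ (Group.normalizerCondition_of_isNilpotent (G := P)) hco
  have hnt : (⊤ : Subgroup (P ⧸ R)) ≠ ⊥ := by
    intro h
    apply hRtop
    rw [← QuotientGroup.ker_mk' R, ← MonoidHom.comap_bot, ← h, Subgroup.comap_top]
  have hprime : (Nat.card (⊤ : Subgroup (P ⧸ R))).Prime := by
    apply prime_card_of _ hnt
    intro X _ hX
    have hs := QuotientGroup.mk'_surjective R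
    apply Subgroup.comap_injective hs
    rw [Subgroup.comap_top]
    apply hco.2
    refine lt_of_le_of_ne ?_ ?_
    · conv_lhs => rw [← QuotientGroup.ker_mk' R]
      exact Subgroup.ker_le_comap _ _
    · intro h
      apply hX
      apply Subgroup.comap_injective hs
      rw [← h, MonoidHom.comap_bot, QuotientGroup.ker_mk']
  rw [Subgroup.card_top] at hprime
  have hcard : Nat.card (P ⧸ R) = p := by
    have h1 : IsPGroup p (P ⧸ R) := hP.to_quotient R
    obtain ⟨n, hn⟩ := (IsPGroup.iff_card).1 h1
    rw [hn] at hprime ⊢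
    have := hprime.eq_one_of_pow
    rw [this, pow_one]
  have hcyc : IsCyclic (P ⧸ R) := isCyclic_of_prime_card hcard
  have hcomm : ∀ a b : P ⧸ R, a * b = b * a := fun a b =>
    (IsCyclic.isMulCommutative (α := P ⧸ R)).is_comm.comm a b
  constructor
  · intro a ha b hb
    have h1 : (QuotientGroup.mk ((⟨a, ha⟩ : P) * ⟨b, hb⟩ * (⟨a, ha⟩ : P)⁻¹ * (⟨b, hb⟩ : P)⁻¹) : P ⧸ R) = 1 := by
      simp only [QuotientGroup.mk_mul, QuotientGroup.mk_inv]
      rw [hcomm (a := QuotientGroup.mk _)]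
      group
    rw [QuotientGroup.eq_one_iff] at h1
    exact h1
  · intro m hm hmP u hu
    have hmem : ∀ u : P, m * u * m⁻¹ ∈ P := fun u =>
      ((Subgroup.mem_normalizer_iff.1 hmP) u).1 u.2
    let φ : P →* P := MonoidHom.mk' (fun u => ⟨m * u * m⁻¹, hmem u⟩) (by
      intro a b; ext; simp)
    have hφR : R ≤ R.comap φ := by
      intro x hx
      change m * x * m⁻¹ ∈ M
      exact M.mul_mem (M.mul_mem hm hx) (M.inv_mem hm)
    let ψ : (P ⧸ R) →* (P ⧸ R) := QuotientGroup.map R R φ hφR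
    obtain ⟨k, hk⟩ := MonoidHom.map_cyclic ψ
    have hφn : ∀ (n : ℕ) (u : P), ((φ^[n] u : P) : G) = m ^ n * u * (m ^ n)⁻¹ := by
      intro n
      induction n with
      | zero => intro u; simp
      | succ n ih =>
        intro u
        rw [Function.iterate_succ_apply, ih]
        change m ^ n * (m * u * m⁻¹) * (m ^ n)⁻¹ = _
        rw [pow_succ]; group
    have hψn : ∀ (n : ℕ) (u : P), (QuotientGroup.mk (φ^[n] u) : P ⧸ R) = (QuotientGroup.mk u) ^ (k ^ n) := by
      intro n
      induction n with
      | zero => intro u; simp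
      | succ n ih =>
        intro u
        rw [Function.iterate_succ_apply, ih]
        have : (QuotientGroup.mk (φ u) : P ⧸ R) = ψ (QuotientGroup.mk u) := rfl
        rw [this, hk, ← zpow_mul, pow_succ, mul_comm]
    have hone : ∀ u : P ⧸ R, u ^ (k ^ orderOf m) = u := by
      intro u
      obtain ⟨u, rfl⟩ := QuotientGroup.mk_surjective u
      rw [← hψn]
      congr 1
      ext
      rw [hφn, pow_orderOf_eq_one]; simp
    obtain ⟨g, hg⟩ := hcyc.exists_generator
    have hgo : orderOf g = p := by rw [orderOf_eq_card_of_forall_mem_zpowers hg, hcard]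
    have hkz : (k : ZMod p) ^ orderOf m = 1 := by
      have h1 := hone g
      have h2 : g ^ (k ^ orderOf m - 1) = 1 := by rw [zpow_sub, h1]; simp
      rw [← orderOf_dvd_iff_zpow_eq_one, hgo, ← ZMod.intCast_zmod_eq_zero_iff_dvd] at h2
      push_cast at h2
      exact sub_eq_zero.1 h2
    have hk0 : (k : ZMod p) ≠ 0 := by
      intro h
      rw [h, zero_pow (orderOf_pos m).ne'] at hkz
      exact zero_ne_one hkz
    have hk1 : (k : ZMod p) = 1 := by
      rw [← orderOf_eq_one_iff]
      have d1 := orderOf_dvd_of_pow_eq_one hkz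
      have d2 := orderOf_dvd_of_pow_eq_one (ZMod.pow_card_sub_one_eq_one hk0)
      by_contra hne
      have hq := Nat.minFac_prime hne
      have hqd := Nat.minFac_dvd (orderOf (k : ZMod p))
      have := hp _ hq ((hqd.trans d1).trans (orderOf_dvd_natCard m))
      have h3 := Nat.le_of_dvd (Nat.sub_pos_of_lt (Fact.out : p.Prime).one_lt) (hqd.trans d2)
      have := (Fact.out : p.Prime).one_lt
      omega
    have hkp : (p : ℤ) ∣ k - 1 := by
      rw [← ZMod.intCast_zmod_eq_zero_iff_dvd]; push_cast; rw [hk1, sub_self]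
    have hψ1 : ψ (QuotientGroup.mk ⟨u, hu⟩) = QuotientGroup.mk ⟨u, hu⟩ := by
      rw [hk]
      set x : P ⧸ R := QuotientGroup.mk ⟨u, hu⟩
      have : x ^ (k - 1) = 1 := by
        rw [← orderOf_dvd_iff_zpow_eq_one]
        refine dvd_trans ?_ hkp
        rw [← hcard]
        exact_mod_cast orderOf_dvd_natCard x
      rw [zpow_sub, zpow_one, mul_inv_eq_one] at this
      exact this
    have h2 : (QuotientGroup.mk (φ ⟨u, hu⟩ * (⟨u, hu⟩ : P)⁻¹) : P ⧸ R) = 1 := by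
      rw [QuotientGroup.mk_mul, QuotientGroup.mk_inv]
      have : (QuotientGroup.mk (φ ⟨u, hu⟩) : P ⧸ R) = ψ (QuotientGroup.mk ⟨u, hu⟩) := rfl
      rw [this, hψ1, mul_inv_cancel]
    rw [QuotientGroup.eq_one_iff] at h2
    exact h2

theorem solvable_aux (n : ℕ) : ∀ (G : Type*) [Group G] [Finite G], Nat.card G = n →
    ∀ {ι : Type*} (M : ι → Subgroup G), (∀ i, MaxInt (M i)) →
      (∀ x, (∀ i, x ∈ M i) → x = 1) → Group.IsSolvable G := by
  induction n using Nat.strong_induction_on with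
  | _ n ih =>
  intro G _ _ hn ι M hM hint
  by_cases h1 : Nat.card G = 1
  · have := (Nat.card_eq_one_iff_unique.1 h1).1
    infer_instance
  set p := (Nat.card G).minFac with hpdef
  have hpp : p.Prime := Nat.minFac_prime h1
  have := Fact.mk hpp
  have hp : ∀ q : ℕ, q.Prime → q ∣ Nat.card G → p ≤ q := fun q hq hd =>
    Nat.minFac_le_of_dvd hq.two_le hd
  let P : Sylow p G := default
  have hNC : Subgroup.normalizer ((P : Subgroup G) : Set G) ≤ Subgroup.centralizer ((P : Subgroup G) : Set G) := by
    intro y hy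
    rw [Subgroup.mem_centralizer_iff]
    intro u hu
    have key : y * u * y⁻¹ * u⁻¹ = 1 := by
      apply hint
      intro i
      by_cases hPM : (P : Subgroup G) ≤ M i
      · apply hPM
        exact mul_mem ((Subgroup.mem_normalizer_iff.1 hy u).1 hu) (inv_mem hu)
      · obtain ⟨s1, s2⟩ := pgroup_step hp (P : Subgroup G) P.isPGroup' (M i) (hM i) hPM
        let N := Subgroup.normalizer ((P : Subgroup G) : Set G)
        let C : Subgroup G :=
          { carrier := {y | y ∈ N ∧ ∀ u ∈ (P : Subgroup G), y * u * y⁻¹ * u⁻¹ ∈ M i}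
            one_mem' := ⟨one_mem _, by intro u _; simp⟩
            mul_mem' := by
              rintro a b ⟨ha, ha'⟩ ⟨hb, hb'⟩
              refine ⟨mul_mem ha hb, fun u hu => ?_⟩
              have e1 := ha' (b * u * b⁻¹) ((Subgroup.mem_normalizer_iff.1 hb u).1 hu)
              have e2 := mul_mem e1 (hb' u hu)
              convert e2 using 1
              group
            inv_mem' := by
              rintro a ⟨ha, ha'⟩
              refine ⟨inv_mem ha, fun u hu => ?_⟩
              have e1 := ha' (a⁻¹ * u * a) ((Subgroup.mem_normalizer_iff''.1 ha u).1 hu)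
              have e2 := inv_mem e1
              convert e2 using 1
              group }
        have hPN : (P : Subgroup G) ≤ N := Subgroup.le_normalizer
        have hX : (P : Subgroup G) ⊔ (N ⊓ M i) = N :=
          hM i _ N le_sup_right (sup_le hPN inf_le_left) (fun h => hPM (le_sup_left.trans h))
        have hXC : (P : Subgroup G) ⊔ (N ⊓ M i) ≤ C :=
          sup_le (fun a ha => ⟨hPN ha, fun b hb => s1 a ha b hb⟩)
            (fun m hm => ⟨hm.1, s2 m hm.2 hm.1⟩)
        rw [hX] at hXC
        exact (hXC hy).2 u hu
    rw [mul_inv_eq_one, mul_inv_eq_iff_eq_mul] at key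
    exact key.symm
  have hnd := MonoidHom.not_dvd_card_ker_transferSylow P hNC
  set τ := MonoidHom.transferSylow P hNC
  have hlt : Nat.card τ.ker < n := by
    rw [← hn]
    refine lt_of_le_of_ne (Subgroup.card_le_card_group _) ?_
    intro h
    exact hnd (h ▸ Nat.minFac_dvd _)
  have hK : Group.IsSolvable τ.ker := by
    refine ih _ hlt τ.ker rfl (fun i => (M i).subgroupOf τ.ker)
      (fun i => (hM i).comap τ.ker.subtype τ.ker.subtype_injective) ?_
    intro x hx
    ext
    exact hint x hx
  have : Group.IsNilpotent P := P.isPGroup'.isNilpotent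
  have : Group.IsSolvable P := inferInstance
  exact Group.isSolvable_of_ker_le_range τ.ker.subtype τ (by simp)

theorem le_normalizer_of {G : Type*} [Group G] {A X : Subgroup G}
    (h : ∀ a ∈ A, ∀ x ∈ X, a * x * a⁻¹ ∈ X) : A ≤ Subgroup.normalizer (X : Set G) := by
  intro a ha
  rw [Subgroup.mem_normalizer_iff]
  refine fun x => ⟨h a ha x, fun hx => ?_⟩
  have := h a⁻¹ (inv_mem ha) _ hx
  convert this using 1
  group

theorem endgame {G : Type*} [Group G] [Finite G] {M : Subgroup G} (hM : MaxInt M)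
    (hmx : ∀ K : Subgroup G, M ≤ K → K ≠ ⊤ → K = M) (hcore : M.normalCore = ⊥)
    (hn : ¬ M.Normal) :
    ∃ p q : ℕ, p.Prime ∧ q.Prime ∧ p ≠ q ∧ Nat.card G = p * q ∧ ¬ ∀ a b : G, a * b = b * a := by
  have hnab : ¬ ∀ a b : G, a * b = b * a := by
    intro h
    apply hn
    refine ⟨fun m hm g => ?_⟩
    rw [h g m]; simpa using hm
  have hnorm : ∀ X : Subgroup G, X.Normal → X ≤ M → X = ⊥ := by
    intro X hX hXM
    rw [← le_bot_iff, ← hcore]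
    exact Subgroup.normal_le_normalCore.2 hXM
  have hbot : ∀ X A : Subgroup G, X ≤ M → ¬ A ≤ M → (∀ a ∈ M, ∀ x ∈ X, a * x * a⁻¹ ∈ X) →
      (∀ a ∈ A, ∀ x ∈ X, a * x * a⁻¹ ∈ X) → X = ⊥ := by
    intro X A hXM hAM h1 h2
    refine hnorm X ?_ hXM
    rw [← Subgroup.normalizer_eq_top_iff]
    by_contra hc
    have := hmx _ (le_normalizer_of h1) hc
    exact hAM (this ▸ le_normalizer_of h2)
  have hsol : Group.IsSolvable G := by
    refine solvable_aux _ G rfl (fun g : G => M.comap (MulAut.conj g).toMonoidHom)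
      (fun g => hM.comap _ (MulAut.conj g).injective) ?_
    intro x hx
    rw [← Subgroup.mem_bot, ← hcore]
    exact hx
  have hMtop : M ≠ ⊤ := by
    rintro rfl
    exact hn inferInstance
  have hnt : (⊤ : Subgroup G) ≠ ⊥ := by
    intro h
    exact hMtop (top_le_iff.1 (h ▸ bot_le))
  obtain ⟨N, hNn, hNb, hNab⟩ : ∃ N : Subgroup G, N.Normal ∧ N ≠ ⊥ ∧ ∀ a ∈ N, ∀ b ∈ N, a * b = b * a := by
    classical
    have hex : ∃ n, derivedSeries G n = ⊥ := hsol.solvable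
    have h0 : Nat.find hex ≠ 0 := by
      intro h
      have := Nat.find_spec hex
      rw [h] at this
      exact hnt this
    obtain ⟨k, hk⟩ := Nat.exists_eq_succ_of_ne_zero h0
    refine ⟨derivedSeries G k, derivedSeries_normal G k, Nat.find_min hex (by omega), ?_⟩
    have h2 := Nat.find_spec hex
    rw [hk, Nat.succ_eq_add_one, derivedSeries_succ, Subgroup.commutator_eq_bot_iff_le_centralizer] at h2
    intro a ha b hb
    exact (h2 hb a ha)
  have hNM : ¬ N ≤ M := fun h => hNb (hnorm N hNn h)
  have hinf : N ⊓ M = ⊥ := by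
    refine hbot _ N inf_le_right hNM ?_ ?_
    · intro a ha x hx
      exact ⟨hNn.conj_mem x hx.1 a, M.mul_mem (M.mul_mem ha hx.2) (M.inv_mem ha)⟩
    · intro a ha x hx
      rw [hNab a ha x hx.1]; simpa using hx
  have hpN : (Nat.card N).Prime := by
    refine prime_card_of N hNb (fun X hXN hX => hM X N (hinf ▸ bot_le) hXN ?_)
    intro h
    exact hX (le_bot_iff.1 (hinf ▸ le_inf hXN h))
  have hcen : M ⊓ Subgroup.centralizer (N : Set G) = ⊥ := by
    refine hbot _ N inf_le_left hNM ?_ ?_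
    · intro a ha x hx
      refine ⟨M.mul_mem (M.mul_mem ha hx.1) (M.inv_mem ha), ?_⟩
      have : (Subgroup.centralizer (N : Set G)).Normal := inferInstance
      exact this.conj_mem x hx.2 a
    · intro a ha x hx
      rw [hx.2 a ha]; simpa using hx
  have hMab : ∀ a ∈ M, ∀ b ∈ M, a * b = b * a := by
    intro a ha b hb
    have := Fact.mk hpN
    have hcyc : IsCyclic N := isCyclic_of_prime_card rfl
    obtain ⟨k, hk⟩ := MonoidHom.map_cyclic (MulAut.conjNormal a : MulAut N).toMonoidHom
    obtain ⟨l, hl⟩ := MonoidHom.map_cyclic (MulAut.conjNormal b : MulAut N).toMonoidHom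
    have hk' : ∀ n : N, a * n * a⁻¹ = (n : G) ^ k := fun n => congrArg Subtype.val (hk n)
    have hl' : ∀ n : N, b * n * b⁻¹ = (n : G) ^ l := fun n => congrArg Subtype.val (hl n)
    have e : ∀ n : N, (a * b) * n * (a * b)⁻¹ = (b * a) * n * (b * a)⁻¹ := by
      intro n
      have e1 : (a * b) * n * (a * b)⁻¹ = a * (b * n * b⁻¹) * a⁻¹ := by group
      have e2 : (b * a) * n * (b * a)⁻¹ = b * (a * n * a⁻¹) * b⁻¹ := by group
      rw [e1, e2, hk', hl', ← conj_zpow, ← conj_zpow, hk', hl', ← zpow_mul, ← zpow_mul, mul_comm]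
    have hc : (b * a)⁻¹ * (a * b) ∈ M ⊓ Subgroup.centralizer (N : Set G) := by
      refine Subgroup.mem_inf.2 ⟨M.mul_mem (M.inv_mem (M.mul_mem hb ha)) (M.mul_mem ha hb), ?_⟩
      rw [Subgroup.mem_centralizer_iff]
      intro n hn
      have := e ⟨n, hn⟩
      simp only at this
      rw [mul_inv_eq_iff_eq_mul] at this
      rw [mul_assoc (b * a)⁻¹, this]
      group
    rw [hcen, Subgroup.mem_bot, inv_mul_eq_one] at hc
    exact hc.symm
  obtain ⟨g, hg⟩ : ∃ g : G, ¬ M.map (MulAut.conj g).toMonoidHom ≤ M := by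
    by_contra! hc
    exact hn ⟨fun m hm g => hc g ⟨m, hm, rfl⟩⟩
  set M' := M.map (MulAut.conj g).toMonoidHom with hM'
  have hcardM : Nat.card M' = Nat.card M :=
    Subgroup.card_map_of_injective (MulAut.conj g).injective
  have hM'ab : ∀ a ∈ M', ∀ b ∈ M', a * b = b * a := by
    rintro _ ⟨a, ha, rfl⟩ _ ⟨b, hb, rfl⟩
    rw [← map_mul, hMab a ha b hb, map_mul]
  have hinf' : M' ⊓ M = ⊥ := by
    refine hbot _ M' inf_le_right hg ?_ ?_
    · intro a ha x hx
      rw [hMab a ha x hx.2]; simpa using hx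
    · intro a ha x hx
      rw [hM'ab a ha x hx.1]; simpa using hx
  have hqM : (Nat.card M).Prime := by
    rw [← hcardM]
    refine prime_card_of M' (fun h => hg (h ▸ bot_le))
      (fun X hXN hX => hM X M' (hinf' ▸ bot_le) hXN ?_)
    intro h
    exact hX (le_bot_iff.1 (hinf' ▸ le_inf hXN h))
  have hcard : Nat.card N * Nat.card M = Nat.card G := by
    have : N ⊔ M = ⊤ := by
      by_contra hc
      exact hNM (le_sup_left.trans (hmx _ le_sup_right hc).le)
    refine (Subgroup.isComplement'_of_disjoint_and_mul_eq_univ (disjoint_iff.2 hinf) ?_).card_mul_card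
    rw [← Subgroup.normal_mul, this, Subgroup.coe_top]
  refine ⟨Nat.card N, Nat.card M, hpN, hqM, ?_, hcard.symm, hnab⟩
  intro heq
  have := Fact.mk hpN
  rw [← heq, ← sq] at hcard
  exact hnab (IsPGroup.isMulCommutative_of_card_eq_prime_sq hcard.symm).is_comm.comm

/-- Schmidt: maximal modular subgroups. -/
theorem stmt9 {G : Type u} [Group G] [Finite G] {M : Subgroup G} (hM : M ≠ ⊤)
    (hmod : IsModularSubgroup M)
    (hmax : ∀ K : Subgroup G, M < K → K < ⊤ → ¬ IsModularSubgroup K) :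
    (∃ _ : M.Normal, IsSimpleGroup (G ⧸ M)) ∨
    (∃ p q : ℕ, p.Prime ∧ q.Prime ∧ p ≠ q ∧
      Nat.card (G ⧸ M.normalCore) = p * q ∧
      ¬ ∀ a b : G ⧸ M.normalCore, a * b = b * a) := by
  by_cases hn : M.Normal
  · left
    refine ⟨hn, ?_⟩
    have hs := QuotientGroup.mk'_surjective M
    have : Nontrivial (G ⧸ M) := QuotientGroup.nontrivial_iff.2 hM
    refine ⟨fun H hH => ?_⟩
    have hK : (H.comap (QuotientGroup.mk' M)).Normal := hH.comap _
    have hle : M ≤ H.comap (QuotientGroup.mk' M) := by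
      conv_lhs => rw [← QuotientGroup.ker_mk' M]
      exact Subgroup.ker_le_comap _ _
    by_contra! hc
    refine hmax (H.comap (QuotientGroup.mk' M)) (lt_of_le_of_ne hle ?_)
      (lt_top_iff_ne_top.2 ?_) ?_
    · intro h
      apply hc.1
      apply Subgroup.comap_injective hs
      rw [← h, MonoidHom.comap_bot, QuotientGroup.ker_mk']
    · intro h
      apply hc.2
      apply Subgroup.comap_injective hs
      rw [h, Subgroup.comap_top]
    · set K := H.comap (QuotientGroup.mk' M)
      constructor
      · intro X Y hXY
        apply le_antisymm
        · rintro z ⟨hz, hzY⟩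
          obtain ⟨x, hx, k, hk, rfl⟩ := Subgroup.mem_sup_of_normal_right.1 hz
          refine mul_mem (Subgroup.mem_sup_left hx) (Subgroup.mem_sup_right ⟨hk, ?_⟩)
          exact (Y.mul_mem_cancel_left (hXY hx)).1 hzY
        · exact sup_le (le_inf le_sup_left hXY) (inf_le_inf_right _ le_sup_right)
      · intro X Y hKY
        apply le_antisymm
        · rintro z ⟨hz, hzY⟩
          obtain ⟨k, hk, x, hx, rfl⟩ := Subgroup.mem_sup_of_normal_left.1 hz
          refine mul_mem (Subgroup.mem_sup_left hk) (Subgroup.mem_sup_right ⟨hx, ?_⟩)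
          exact (Y.mul_mem_cancel_left (hKY hk)).1 hzY
        · exact sup_le (le_inf le_sup_left hKY) (inf_le_inf_right _ le_sup_right)
  · right
    have hmx := maximal_of_nonnormal hmod hmax hn
    have hMI : MaxInt M := by
      intro X Y h1 h2 h3
      have h4 : X ⊔ M = ⊤ := by
        by_contra hc
        exact h3 (le_sup_left.trans (hmx _ le_sup_right hc).le)
      have h5 := hmod.1 X Y h2
      rw [h4, top_inf_eq, inf_comm, sup_eq_left.2 h1] at h5
      exact h5.symm
    have hs := QuotientGroup.mk'_surjective M.normalCore
    have hcm : (M.map (QuotientGroup.mk' M.normalCore)).comap (QuotientGroup.mk' M.normalCore) = M := by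
      apply Subgroup.comap_map_eq_self
      rw [QuotientGroup.ker_mk']
      exact M.normalCore_le
    refine endgame (hMI.map _ hs) ?_ ?_ ?_
    · intro K hK hKt
      apply Subgroup.comap_injective hs
      rw [hcm]
      refine hmx _ (hcm.ge.trans (Subgroup.comap_mono hK)) ?_
      intro h
      apply hKt
      apply Subgroup.comap_injective hs
      rw [h, Subgroup.comap_top]
    · set C := (M.map (QuotientGroup.mk' M.normalCore)).normalCore
      have hC : (C.comap (QuotientGroup.mk' M.normalCore)).Normal := Subgroup.Normal.comap inferInstance _
      have hCM : C.comap (QuotientGroup.mk' M.normalCore) ≤ M.normalCore := by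
        apply Subgroup.normal_le_normalCore.2
        exact (Subgroup.comap_mono (Subgroup.normalCore_le _)).trans hcm.le
      apply Subgroup.comap_injective hs
      rw [MonoidHom.comap_bot, QuotientGroup.ker_mk']
      apply le_antisymm hCM
      conv_lhs => rw [← QuotientGroup.ker_mk' M.normalCore]
      exact Subgroup.ker_le_comap _ _
    · intro h
      exact hn (hcm ▸ h.comap _)
end

section
/- Every submodular subgroup of a finite group G is K𝔘₁-subnormal in G, where 𝔘₁ is the class of supersolvable groups of square-free exponent. -/
universe u

/-- The part of modularity of a maximal subgroup that is used. -/
def GoodSub {G : Type u} [Group G] (M : Subgroup G) : Prop :=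
  ∀ X Y : Subgroup G, X ≤ Y → ¬ X ≤ M → Y ≤ X ⊔ (M ⊓ Y)

theorem GoodSub.subgroupOf {G : Type u} [Group G] {M : Subgroup G} (h : GoodSub M)
    (K : Subgroup G) : GoodSub (M.subgroupOf K) := by
  intro X Y hXY hX
  have h1 : ¬ X.map K.subtype ≤ M := by
    intro h2
    exact hX (Subgroup.map_le_iff_le_comap.1 h2)
  have h2 := h (X.map K.subtype) (Y.map K.subtype) (Subgroup.map_mono hXY) h1
  have h3 : M ⊓ Y.map K.subtype ≤ (M.subgroupOf K ⊓ Y).map K.subtype := by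
    rintro x ⟨hx1, y, hy, rfl⟩
    exact ⟨y, ⟨hx1, hy⟩, rfl⟩
  have h4 : Y.map K.subtype ≤ (X ⊔ (M.subgroupOf K ⊓ Y)).map K.subtype := by
    rw [Subgroup.map_sup]
    exact h2.trans (sup_le_sup_left h3 _)
  exact (Subgroup.map_le_map_iff_of_injective K.subtype_injective).1 h4

theorem card_prime_of_atom {G : Type u} [Group G] [Finite G] {A : Subgroup G} (hA : A ≠ ⊥)
    (h : ∀ X : Subgroup G, X ≤ A → X ≠ ⊥ → A ≤ X) : (Nat.card A).Prime := by
  have h1 : Nat.card A ≠ 1 := by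
    intro h2
    exact hA (Subgroup.card_eq_one.1 h2)
  have hp := Nat.minFac_prime h1
  have := Fact.mk hp
  obtain ⟨x, hx⟩ := exists_prime_orderOf_dvd_card' (G := A) _ (Nat.minFac_dvd (Nat.card A))
  have h2 : Subgroup.zpowers (x : G) ≤ A := by
    simp
  have h3 : Subgroup.zpowers (x : G) ≠ ⊥ := by
    intro h4
    rw [Subgroup.zpowers_eq_bot] at h4
    have : x = 1 := Subtype.ext h4
    rw [this, orderOf_one] at hx
    exact hp.one_lt.ne hx
  have h4 : A = Subgroup.zpowers (x : G) := le_antisymm (h _ h2 h3) h2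
  have h5 : Nat.card A = orderOf (x : G) := by
    rw [← Nat.card_zpowers]
    exact congrArg (fun B : Subgroup G => Nat.card B) h4
  rw [h5, Subgroup.orderOf_coe, hx]
  exact hp

theorem central_of_prime {Q : Type u} [Group Q] [Finite Q] (N : Subgroup Q) [N.Normal] {s : ℕ}
    (hs : s.Prime) (hN : Nat.card N = s) (hc : (Nat.card Q).Coprime (s - 1)) (y n : Q)
    (hn : n ∈ N) : y * n * y⁻¹ = n := by
  have := Fact.mk hs
  have : IsCyclic N := isCyclic_of_prime_card hN
  have h1 : orderOf (MulAut.conjNormal (H := N) y) ∣ Nat.card Q :=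
    (orderOf_map_dvd _ y).trans (orderOf_dvd_natCard y)
  have h2 : orderOf (MulAut.conjNormal (H := N) y) ∣ s - 1 := by
    have := orderOf_dvd_natCard (MulAut.conjNormal (H := N) y)
    rwa [IsCyclic.card_mulAut, hN, Nat.totient_prime hs] at this
  have h3 := Nat.eq_one_of_dvd_coprimes hc h1 h2
  rw [orderOf_eq_one_iff] at h3
  have := MulAut.conjNormal_apply (H := N) y ⟨n, hn⟩
  rw [h3] at this
  exact this.symm

theorem comm_mem_of_normal {Γ : Type u} [Group Γ] [Finite Γ] {M : Subgroup Γ} (hM : GoodSub M)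
    {s : ℕ} (hs : s.Prime) (R : Subgroup Γ) [hRn : R.Normal] (hR : IsPGroup s R)
    (hc : (Nat.card Γ).Coprime (s - 1)) (y r : Γ) (hr : r ∈ R) : y * r * y⁻¹ * r⁻¹ ∈ M := by
  have := Fact.mk hs
  by_cases hRM : R ≤ M
  · exact hRM (R.mul_mem (hRn.conj_mem r hr y) (R.inv_mem hr))
  have htop : (⊤ : Subgroup Γ) ≤ R ⊔ M := by
    have := hM R ⊤ le_top hRM
    simpa using this
  -- `R ⊓ M` is normal
  have hco : IsCoatom ((R ⊓ M).subgroupOf R) := by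
    constructor
    · intro h
      rw [Subgroup.subgroupOf_eq_top] at h
      exact hRM (h.trans inf_le_right)
    · intro X hX
      have h1 : ¬ X.map R.subtype ≤ M := by
        intro h2
        refine hX.not_ge ?_
        intro x hx
        exact ⟨x.2, h2 ⟨x, hx, rfl⟩⟩
      have h2 := hM (X.map R.subtype) R (Subgroup.map_subtype_le X) h1
      have h3 : M ⊓ R ≤ X.map R.subtype := by
        rintro x ⟨hx1, hx2⟩
        exact ⟨⟨x, hx2⟩, hX.le ⟨hx2, hx1⟩, rfl⟩
      rw [sup_eq_left.2 h3] at h2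
      rw [eq_top_iff]
      rintro x -
      obtain ⟨z, hz, hzx⟩ := h2 x.2
      have : z = x := Subtype.ext hzx
      exact this ▸ hz
  have hnil : Group.IsNilpotent R := hR.isNilpotent
  have hn1 : ((R ⊓ M).subgroupOf R).Normal :=
    Subgroup.NormalizerCondition.normal_of_coatom _ Group.normalizerCondition_of_isNilpotent hco
  have hn2 : R ≤ Subgroup.normalizer (R ⊓ M : Subgroup Γ) :=
    (Subgroup.normal_subgroupOf_iff_le_normalizer inf_le_left).1 hn1
  have hn3 : M ≤ Subgroup.normalizer (R ⊓ M : Subgroup Γ) := by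
    rw [Subgroup.le_normalizer_iff]
    rintro m hm k ⟨hk1, hk2⟩
    exact ⟨hRn.conj_mem k hk1 m, M.mul_mem (M.mul_mem hm hk2) (M.inv_mem hm)⟩
  have hn : (R ⊓ M).Normal := by
    rw [← Subgroup.normalizer_eq_top_iff, eq_top_iff]
    exact htop.trans (sup_le hn2 hn3)
  let π := QuotientGroup.mk' (R ⊓ M)
  have hπs : Function.Surjective π := QuotientGroup.mk'_surjective _
  have : (R.map π).Normal := hRn.map π hπs
  have hker : π.ker = R ⊓ M := QuotientGroup.ker_mk' _
  have hpr : (Nat.card (R.map π)).Prime := by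
    apply card_prime_of_atom
    · intro h
      rw [Subgroup.map_eq_bot_iff, hker] at h
      exact hRM (h.trans inf_le_right)
    · intro X hX hX1
      have h0 : R ⊓ M ≤ X.comap π := by
        exact hker.symm.le.trans (Subgroup.ker_le_comap _ _)
      have h1 : X.comap π ≤ R := by
        refine (Subgroup.comap_mono hX).trans ?_
        rw [Subgroup.comap_map_eq, hker]
        exact sup_le le_rfl inf_le_left
      have h2 : ¬ X.comap π ≤ M := by
        intro h3
        apply hX1
        have h4 : X.comap π ≤ π.ker := by
          rw [hker]
          exact le_inf h1 h3
        have h5 := (Subgroup.map_eq_bot_iff (f := π) (X.comap π)).2 h4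
        rwa [Subgroup.map_comap_eq_self_of_surjective hπs] at h5
      have h3 := hM _ _ h1 h2
      exact Subgroup.map_le_iff_le_comap.2
        (h3.trans (sup_le le_rfl ((le_inf inf_le_right inf_le_left).trans h0)))
  have hcard : Nat.card (R.map π) = s := by
    have h1 : IsPGroup s (R.map π) := hR.map π
    rcases h1.card_eq_or_dvd with h2 | h2
    · exact absurd h2 hpr.one_lt.ne'
    · exact ((Nat.prime_dvd_prime_iff_eq hs hpr).1 h2).symm
  have hc2 : (Nat.card (Γ ⧸ (R ⊓ M))).Coprime (s - 1) :=
    hc.coprime_dvd_left (Subgroup.card_quotient_dvd_card _)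
  have := central_of_prime (R.map π) hs hcard hc2 (π y) (π r) ⟨r, hr, rfl⟩
  have h2 : y * r * y⁻¹ * r⁻¹ ∈ π.ker := by
    rw [MonoidHom.mem_ker, map_mul, map_mul, map_mul, map_inv, map_inv, this, mul_inv_cancel]
  rw [hker] at h2
  exact h2.2

theorem solvable_of_good (n : ℕ) : ∀ (Γ : Type u) [Group Γ] [Finite Γ] (F : Set (Subgroup Γ)),
    Nat.card Γ = n → (∀ M ∈ F, GoodSub M) → (∀ x : Γ, (∀ M ∈ F, x ∈ M) → x = 1) →
    Group.IsSolvable Γ := by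
  induction n using Nat.strong_induction_on with
  | _ n ih =>
  intro Γ _ _ F hn hF hF1
  by_cases h1 : Nat.card Γ = 1
  · have := (Nat.card_eq_one_iff_unique.1 h1).1
    exact Group.isSolvable_of_comm fun a b => Subsingleton.elim _ _
  have hs := Nat.minFac_prime h1
  set s := (Nat.card Γ).minFac with hsdef
  have := Fact.mk hs
  have hc : (Nat.card Γ).Coprime (s - 1) := by
    by_contra hcon
    obtain ⟨q, hq, hq1, hq2⟩ := Nat.Prime.not_coprime_iff_dvd.1 hcon
    have h2 : s ≤ q := Nat.minFac_le_of_dvd hq.two_le hq1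
    have h3 : q ≤ s - 1 := Nat.le_of_dvd (by have := hs.two_le; omega) hq2
    have := hs.two_le
    omega
  obtain ⟨P⟩ : Nonempty (Sylow s Γ) := inferInstance
  have hP : Subgroup.normalizer P ≤ Subgroup.centralizer (P : Set Γ) := by
    intro y hy
    rw [Subgroup.mem_centralizer_iff]
    intro r hr
    have hrY : r ∈ Subgroup.normalizer (P : Subgroup Γ) := Subgroup.le_normalizer hr
    have key : y * r * y⁻¹ * r⁻¹ = 1 := by
      apply hF1
      intro M hM
      let Y : Subgroup Γ := Subgroup.normalizer (P : Subgroup Γ)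
      have : ((P : Subgroup Γ).subgroupOf Y).Normal := Subgroup.normal_in_normalizer
      have hcY : (Nat.card Y).Coprime (s - 1) := hc.coprime_dvd_left (Subgroup.card_subgroup_dvd_card _)
      have hPY : IsPGroup s ((P : Subgroup Γ).subgroupOf Y) := P.isPGroup'.comap_subtype
      exact comm_mem_of_normal ((hF M hM).subgroupOf Y) hs ((P : Subgroup Γ).subgroupOf Y) hPY hcY
        ⟨y, hy⟩ ⟨r, hrY⟩ hr
    have : y * r = r * y := by
      have h5 := mul_inv_eq_one.1 key
      exact mul_inv_eq_iff_eq_mul.1 h5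
    exact this.symm
  let f := MonoidHom.transferSylow P hP
  have hnd : ¬ s ∣ Nat.card f.ker := MonoidHom.not_dvd_card_ker_transferSylow P hP
  have hlt : Nat.card f.ker < n := by
    have h2 : Nat.card f.ker ∣ Nat.card Γ := Subgroup.card_subgroup_dvd_card _
    have h3 : Nat.card f.ker ≤ Nat.card Γ := Nat.le_of_dvd Nat.card_pos h2
    rw [← hn]
    refine lt_of_le_of_ne h3 ?_
    intro h4
    exact hnd (h4 ▸ Nat.minFac_dvd _)
  have : Group.IsSolvable f.ker := by
    refine ih _ hlt f.ker ((fun M => M.subgroupOf f.ker) '' F) rfl ?_ ?_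
    · rintro _ ⟨M, hM, rfl⟩
      exact (hF M hM).subgroupOf _
    · intro x hx
      apply Subtype.ext
      apply hF1
      intro M hM
      exact hx _ ⟨M, hM, rfl⟩
  have : Group.IsNilpotent P := P.isPGroup'.isNilpotent
  have : Group.IsSolvable P := inferInstance
  exact Group.isSolvable_of_ker_le_range f.ker.subtype f (by simp)

theorem IsModularSubgroup.map_iso {G : Type u} [Group G] {M : Subgroup G}
    (h : IsModularSubgroup M) (E : Subgroup G ≃o Subgroup G) : IsModularSubgroup (E M) := by
  constructor
  · intro X Y hXY
    obtain ⟨X, rfl⟩ := E.surjective X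
    obtain ⟨Y, rfl⟩ := E.surjective Y
    rw [← map_sup, ← map_inf, ← map_inf, ← map_sup, h.1 X Y (E.le_iff_le.1 hXY)]
  · intro X Y hXY
    obtain ⟨X, rfl⟩ := E.surjective X
    obtain ⟨Y, rfl⟩ := E.surjective Y
    rw [← map_sup, ← map_inf, ← map_inf, ← map_sup, h.2 X Y (E.le_iff_le.1 hXY)]

theorem GoodSub.map_iso {G : Type u} [Group G] {M : Subgroup G}
    (h : GoodSub M) (E : Subgroup G ≃o Subgroup G) : GoodSub (E M) := by
  intro X Y hXY hX
  obtain ⟨X, rfl⟩ := E.surjective X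
  obtain ⟨Y, rfl⟩ := E.surjective Y
  rw [← map_inf, ← map_sup, E.le_iff_le]
  exact h X Y (E.le_iff_le.1 hXY) (fun h2 => hX (E.le_iff_le.2 h2))

theorem IsModularSubgroup.good {G : Type u} [Group G] {M : Subgroup G}
    (h : IsModularSubgroup M) (hM : IsCoatom M) : GoodSub M := by
  intro X Y hXY hX
  have h1 : X ⊔ M = ⊤ := by
    apply hM.2
    refine lt_of_le_of_ne le_sup_right ?_
    intro h2
    exact hX (h2 ▸ le_sup_left)
  have := h.1 X Y hXY
  rw [h1, top_inf_eq] at this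
  exact this.le

theorem IsModularSubgroup.sup {G : Type u} [Group G] {M N : Subgroup G}
    (hM : IsModularSubgroup M) (hN : IsModularSubgroup N) : IsModularSubgroup (M ⊔ N) := by
  constructor
  · intro X Y hXY
    apply le_antisymm
    · have e1 := hM.2 (X ⊔ N) (M ⊔ Y) le_sup_left
      rw [hN.1 X (M ⊔ Y) (hXY.trans le_sup_right)] at e1
      have e2 := hM.2 N (M ⊔ Y) le_sup_left
      have e3 := hM.2 Y (M ⊔ N) le_sup_left
      have e4 := hM.1 (X ⊔ ((M ⊔ N) ⊓ Y)) Y (sup_le hXY inf_le_right)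
      have a1 : X ⊔ (M ⊔ N) ≤ M ⊔ (X ⊔ N) :=
        sup_le (le_sup_left.trans le_sup_right)
          (sup_le le_sup_left (le_sup_right.trans le_sup_right))
      have a2 : (X ⊔ (M ⊔ N)) ⊓ Y ≤ M ⊔ (X ⊔ N ⊓ (M ⊔ Y)) := by
        rw [← e1]
        exact inf_le_inf a1 le_sup_right
      have a3 : N ⊓ (M ⊔ Y) ≤ M ⊔ ((M ⊔ N) ⊓ Y) := by
        rw [inf_comm (M ⊔ N) Y, ← e3, inf_comm]
        exact inf_le_inf le_rfl le_sup_right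
      have a4 : M ⊔ (X ⊔ N ⊓ (M ⊔ Y)) ≤ (X ⊔ ((M ⊔ N) ⊓ Y)) ⊔ M := by
        refine sup_le le_sup_right (sup_le (le_sup_left.trans le_sup_left) (a3.trans ?_))
        exact sup_le le_sup_right (le_sup_right.trans le_sup_left)
      calc (X ⊔ (M ⊔ N)) ⊓ Y ≤ ((X ⊔ ((M ⊔ N) ⊓ Y)) ⊔ M) ⊓ Y :=
            le_inf (a2.trans a4) inf_le_right
        _ = (X ⊔ ((M ⊔ N) ⊓ Y)) ⊔ (M ⊓ Y) := e4
        _ ≤ X ⊔ ((M ⊔ N) ⊓ Y) :=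
            sup_le le_rfl ((inf_le_inf le_sup_left le_rfl).trans le_sup_right)
    · exact sup_le (le_inf le_sup_left hXY) (inf_le_inf le_sup_right le_rfl)
  · intro X Y hY
    rw [sup_assoc, hM.2 (N ⊔ X) Y (le_sup_left.trans hY), hN.2 X Y (le_sup_right.trans hY),
      sup_assoc]

/-- Maximal modular non-normal subgroups are maximal subgroups. -/
theorem coatom_of_maximal_modular {G : Type u} [Group G] {M : Subgroup G}
    (hM : IsModularSubgroup M) (hmax : ∀ S, IsModularSubgroup S → M < S → S = ⊤)
    (hn : ¬ M.Normal) : IsCoatom M := by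
  have key : ∀ X : Subgroup G, ¬ X ≤ Subgroup.normalizer (M : Set G) → M ⊔ X = ⊤ := by
    intro X hX
    obtain ⟨x, hx, hxN⟩ := SetLike.not_le_iff_exists.1 hX
    have h1 : IsModularSubgroup (M ⊔ (MulAut.conj x).mapSubgroup M) :=
      hM.sup (hM.map_iso _)
    by_contra hne
    have h2 : ∀ y ∈ X, ∀ m ∈ M, y * m * y⁻¹ ∈ M ⊔ X := fun y hy m hm =>
      mul_mem (mul_mem (Subgroup.mem_sup_right hy) (Subgroup.mem_sup_left hm))
        (inv_mem (Subgroup.mem_sup_right hy))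
    have h3 : ∀ y ∈ X, ∀ m ∈ M, y * m * y⁻¹ ∈ M := by
      intro y hy m hm
      have h1 : IsModularSubgroup (M ⊔ (MulAut.conj y).mapSubgroup M) :=
        hM.sup (hM.map_iso _)
      have h4 : (MulAut.conj y).mapSubgroup M ≤ M ⊔ X := by
        rintro _ ⟨m, hm, rfl⟩
        exact h2 y hy m hm
      have h5 : M ⊔ (MulAut.conj y).mapSubgroup M = M := by
        by_contra h6
        have := hmax _ h1 (lt_of_le_of_ne le_sup_left (Ne.symm h6))
        exact hne (top_le_iff.1 (this ▸ sup_le le_sup_left h4))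
      have h6 : (MulAut.conj y).mapSubgroup M ≤ M := sup_eq_left.1 h5
      exact h6 ⟨m, hm, rfl⟩
    exact hX (Subgroup.le_normalizer_iff.2 h3)
  have hS : IsModularSubgroup (Subgroup.normalizer (M : Set G)) := by
    have hMS : M ≤ Subgroup.normalizer (M : Set G) := Subgroup.le_normalizer
    generalize Subgroup.normalizer (M : Set G) = S at key hMS
    constructor
    · intro X Y hXY
      refine le_antisymm ?_ (sup_le (le_inf le_sup_left hXY) (inf_le_inf le_sup_right le_rfl))
      by_cases hX : X ≤ S
      · rw [sup_eq_right.2 hX]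
        exact le_sup_right
      · have h1 := hM.1 X Y hXY
        rw [sup_comm X M, key X hX, top_inf_eq] at h1
        refine inf_le_right.trans (h1.le.trans ?_)
        exact sup_le_sup_left (inf_le_inf hMS le_rfl) _
    · intro X Y hY
      refine le_antisymm ?_ (sup_le (le_inf le_sup_left hY) (inf_le_inf le_sup_right le_rfl))
      by_cases hX : X ≤ S
      · rw [sup_eq_left.2 hX]
        exact inf_le_left.trans le_sup_left
      · have h1 := hM.2 X Y (hMS.trans hY)
        rw [key X hX, top_inf_eq] at h1
        refine inf_le_right.trans (h1.le.trans ?_)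
        exact sup_le_sup_right hMS _
  have hne : Subgroup.normalizer (M : Set G) ≠ ⊤ := fun h =>
    hn (Subgroup.normalizer_eq_top_iff.1 h)
  have hSM : Subgroup.normalizer (M : Set G) = M := by
    by_contra h
    exact hne (hmax _ hS (lt_of_le_of_ne Subgroup.le_normalizer (Ne.symm h)))
  constructor
  · rintro rfl
    exact hn inferInstance
  · intro Z hZ
    rw [← key Z (by rw [hSM]; exact hZ.not_ge)]
    exact (sup_eq_right.2 hZ.le).symm

theorem exists_abelian_normal {G : Type u} [Group G] [Nontrivial G] [Group.IsSolvable G] :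
    ∃ A : Subgroup G, A.Normal ∧ A ≠ ⊥ ∧ ∀ a ∈ A, ∀ b ∈ A, a * b = b * a := by
  classical
  have hex : ∃ n, derivedSeries G n = ⊥ := Group.IsSolvable.solvable
  have h1 := Nat.find_spec hex
  obtain h0 | ⟨n, hn⟩ : Nat.find hex = 0 ∨ ∃ n, Nat.find hex = n + 1 := by
    cases h : Nat.find hex
    · exact Or.inl rfl
    · exact Or.inr ⟨_, rfl⟩
  · rw [h0, derivedSeries_zero] at h1
    exact absurd h1 top_ne_bot
  · refine ⟨derivedSeries G n, derivedSeries_normal G n, Nat.find_min hex (by omega), ?_⟩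
    intro a ha b hb
    rw [hn, derivedSeries_succ] at h1
    have := Subgroup.commutator_mem_commutator ha hb
    rw [h1, Subgroup.mem_bot] at this
    exact commutatorElement_eq_one_iff_mul_comm.1 this

theorem U1_of_coatom {G : Type u} [Group G] [Finite G] {M : Subgroup G} (hMc : IsCoatom M)
    (hM : IsModularSubgroup M) (hn : ¬ M.Normal) (hcore : M.normalCore = ⊥) : U1 G := by
  have hg := hM.good hMc
  have hMtop : M ≠ ⊤ := hMc.1
  have hnt : Nontrivial G := by
    by_contra h
    rw [not_nontrivial_iff_subsingleton] at h
    exact hMtop (Subsingleton.elim _ _)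
  have hsol : Group.IsSolvable G := by
    refine solvable_of_good _ G (Set.range fun g : G => (MulAut.conj g).mapSubgroup M) rfl ?_ ?_
    · rintro _ ⟨g, rfl⟩
      exact hg.map_iso _
    · intro x hx
      have : x ∈ M.normalCore := by
        intro b
        obtain ⟨m, hm, hmx⟩ := hx _ ⟨b⁻¹, rfl⟩
        have : b⁻¹ * m * b = x := by simpa using hmx
        rw [← this]
        simpa [mul_assoc] using hm
      rwa [hcore, Subgroup.mem_bot] at this
  have core : ∀ N : Subgroup G, N.Normal → N ≤ M → N = ⊥ := by
    intro N hN hNM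
    rw [eq_bot_iff, ← hcore]
    exact Subgroup.normal_le_normalCore.2 hNM
  have supTop : ∀ X : Subgroup G, ¬ X ≤ M → X ⊔ M = ⊤ := by
    intro X hX
    have := hg X ⊤ le_top hX
    simpa using this
  obtain ⟨A, hAn, hA, hAc⟩ := exists_abelian_normal (G := G)
  have hAM : ¬ A ≤ M := fun h => hA (core A hAn h)
  have hAM1 : A ⊓ M = ⊥ := by
    apply core _ _ inf_le_right
    rw [← Subgroup.normalizer_eq_top_iff, eq_top_iff, ← supTop A hAM]
    refine sup_le ?_ ?_ <;> rw [Subgroup.le_normalizer_iff]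
    · rintro a ha k ⟨hk1, hk2⟩
      rw [hAc a ha k hk1, mul_inv_cancel_right]
      exact ⟨hk1, hk2⟩
    · rintro m hm k ⟨hk1, hk2⟩
      exact ⟨hAn.conj_mem k hk1 m, M.mul_mem (M.mul_mem hm hk2) (M.inv_mem hm)⟩
  have hAp : (Nat.card A).Prime := by
    apply card_prime_of_atom hA
    intro X hX hX1
    have h1 : ¬ X ≤ M := fun h => hX1 (by rw [eq_bot_iff, ← hAM1]; exact le_inf hX h)
    have h2 := hg X A hX h1
    rwa [inf_comm, hAM1, sup_bot_eq] at h2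
  have hAf := Fact.mk hAp
  have hAcyc : IsCyclic A := isCyclic_of_prime_card rfl
  -- `M` is abelian
  have hMcent : M ⊓ Subgroup.centralizer (A : Set G) = ⊥ := by
    apply core _ _ inf_le_left
    rw [← Subgroup.normalizer_eq_top_iff, eq_top_iff, ← supTop A hAM]
    refine sup_le ?_ ?_ <;> rw [Subgroup.le_normalizer_iff]
    · rintro a ha k ⟨hk1, hk2⟩
      rw [Subgroup.mem_centralizer_iff.1 hk2 a ha, mul_inv_cancel_right]
      exact ⟨hk1, hk2⟩
    · rintro m hm k ⟨hk1, hk2⟩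
      refine ⟨M.mul_mem (M.mul_mem hm hk1) (M.inv_mem hm), ?_⟩
      have : (Subgroup.centralizer (A : Set G)).Normal := inferInstance
      exact this.conj_mem k hk2 m
  have autComm : ∀ f g : MulAut A, f * g = g * f := by
    intro f g
    obtain ⟨a, ha⟩ := IsCyclic.exists_generator (α := A)
    obtain ⟨i, hi⟩ := Subgroup.mem_zpowers_iff.1 (ha (f a))
    obtain ⟨j, hj⟩ := Subgroup.mem_zpowers_iff.1 (ha (g a))
    ext x
    obtain ⟨k, rfl⟩ := Subgroup.mem_zpowers_iff.1 (ha x)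
    rw [MulAut.mul_apply, MulAut.mul_apply, map_zpow, map_zpow, map_zpow, map_zpow,
      ← hi, ← hj, map_zpow, map_zpow, ← hi, ← hj, ← zpow_mul, ← zpow_mul, ← zpow_mul, ← zpow_mul,
      mul_left_comm i j k]
  have hMc2 : ∀ a ∈ M, ∀ b ∈ M, a * b = b * a := by
    intro a ha b hb
    have h1 : MulAut.conjNormal (H := A) (a * b * a⁻¹ * b⁻¹) = 1 := by
      rw [map_mul, map_mul, map_mul, map_inv, map_inv, autComm (MulAut.conjNormal a),
        mul_inv_cancel_right, mul_inv_cancel]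
    have h2 : a * b * a⁻¹ * b⁻¹ ∈ M ⊓ Subgroup.centralizer (A : Set G) := by
      refine ⟨M.mul_mem (M.mul_mem (M.mul_mem ha hb) (M.inv_mem ha)) (M.inv_mem hb), ?_⟩
      refine Subgroup.mem_centralizer_iff.2 ?_
      intro x hx
      have h3 := MulAut.conjNormal_apply (H := A) (a * b * a⁻¹ * b⁻¹) ⟨x, hx⟩
      rw [h1] at h3
      exact eq_mul_inv_iff_mul_eq.1 h3
    rw [hMcent, Subgroup.mem_bot] at h2
    exact mul_inv_eq_iff_eq_mul.1 (mul_inv_eq_one.1 h2)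
  -- a second conjugate of `M`
  obtain ⟨g, hgM⟩ : ∃ g : G, ¬ (MulAut.conj g).mapSubgroup M ≤ M := by
    by_contra h
    push Not at h
    exact hn ⟨fun m hm g => h g ⟨m, hm, rfl⟩⟩
  have hLc : ∀ a ∈ (MulAut.conj g).mapSubgroup M, ∀ b ∈ (MulAut.conj g).mapSubgroup M,
      a * b = b * a := by
    rintro _ ⟨a, ha, rfl⟩ _ ⟨b, hb, rfl⟩
    rw [← map_mul, hMc2 a ha b hb, map_mul]
  have hLcard : Nat.card ((MulAut.conj g).mapSubgroup M) = Nat.card M :=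
    Subgroup.card_map_of_injective (MulAut.conj g).injective
  have hMp : (Nat.card M).Prime := by
    rw [← hLcard]
    generalize (MulAut.conj g).mapSubgroup M = L at hgM hLc
    have hLM : L ⊓ M = ⊥ := by
      apply core _ _ inf_le_right
      rw [← Subgroup.normalizer_eq_top_iff, eq_top_iff, ← supTop L hgM]
      refine sup_le ?_ ?_ <;> rw [Subgroup.le_normalizer_iff]
      · rintro a ha k ⟨hk1, hk2⟩
        rw [hLc a ha k hk1, mul_inv_cancel_right]
        exact ⟨hk1, hk2⟩
      · rintro a ha k ⟨hk1, hk2⟩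
        rw [hMc2 a ha k hk2, mul_inv_cancel_right]
        exact ⟨hk1, hk2⟩
    apply card_prime_of_atom
    · rintro rfl
      exact hgM bot_le
    · intro X hX hX1
      have h1 : ¬ X ≤ M := fun h => hX1 (by rw [eq_bot_iff, ← hLM]; exact le_inf hX h)
      have h2 := hg X L hX h1
      rwa [inf_comm, hLM, sup_bot_eq] at h2
  have hMf := Fact.mk hMp
  have hMcyc : IsCyclic M := isCyclic_of_prime_card rfl
  have hcompl : Subgroup.IsComplement' A M :=
    Subgroup.isComplement'_of_disjoint_and_mul_eq_univ (disjoint_iff.2 hAM1) (by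
      rw [← Subgroup.normal_mul, supTop A hAM, Subgroup.coe_top])
  have hcard : Nat.card A * Nat.card M = Nat.card G := hcompl.card_mul_card
  have hne : Nat.card A ≠ Nat.card M := by
    intro h
    have h2 : Nat.card G = Nat.card A ^ 2 := by rw [← hcard, ← h, sq]
    have h3 := IsPGroup.isMulCommutative_of_card_eq_prime_sq h2
    exact hn ⟨fun m hm g => by
      rw [mul_comm' g m, mul_inv_cancel_right]; exact hm⟩
  refine ⟨⟨2, ![⊥, A, ⊤], rfl, rfl, ?_, ?_⟩, ?_⟩
  · intro i
    fin_cases i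
    · exact (inferInstance : (⊥ : Subgroup G).Normal)
    · exact hAn
    · exact (inferInstance : (⊤ : Subgroup G).Normal)
  · have gen : ∀ B : Subgroup G, IsCyclic B → ∃ b : G, Subgroup.zpowers b = B := by
      intro B hB
      exact (Subgroup.isCyclic_iff_exists_zpowers_eq_top B).1 hB
    intro i
    fin_cases i
    · obtain ⟨a, ha⟩ := gen A hAcyc
      refine ⟨a, ?_⟩
      change A = ⊥ ⊔ _
      rw [ha, bot_sup_eq]
    · obtain ⟨a, ha⟩ := gen M hMcyc
      refine ⟨a, ?_⟩
      change ⊤ = A ⊔ _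
      rw [ha, supTop A hAM]
  · have hsq : Squarefree (Nat.card G) := by
      rw [← hcard, Nat.squarefree_mul ((Nat.coprime_primes hAp hMp).2 hne)]
      exact ⟨hAp.prime.squarefree, hMp.prime.squarefree⟩
    exact hsq.squarefree_of_dvd Group.exponent_dvd_nat_card

theorem normal_or_residual_of_coatom {G : Type u} [Group G] [Finite G] {M : Subgroup G}
    (hMc : IsCoatom M) (hM : IsModularSubgroup M) : M.Normal ∨ fResidual U1 G ≤ M := by
  by_cases hn : M.Normal
  · exact Or.inl hn
  right
  let N := M.normalCore
  have hNM : N ≤ M := M.normalCore_le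
  let π := QuotientGroup.mk' N
  have hπ : Function.Surjective π := QuotientGroup.mk'_surjective N
  have hker : π.ker = N := QuotientGroup.ker_mk' N
  have hcm : (M.map π).comap π = M := by
    rw [Subgroup.comap_map_eq, hker, sup_eq_left.2 hNM]
  have inj := Subgroup.comap_injective hπ
  have csup : ∀ X Y : Subgroup (G ⧸ N), (X ⊔ Y).comap π = X.comap π ⊔ Y.comap π :=
    fun X Y => (Subgroup.comap_sup_eq π X Y hπ).symm
  have hU : U1 (G ⧸ N) := by
    refine U1_of_coatom (M := M.map π) ?_ ?_ ?_ ?_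
    · constructor
      · intro h
        rw [h, Subgroup.comap_top] at hcm
        exact hMc.1 hcm.symm
      · intro X hX
        apply inj
        rw [Subgroup.comap_top]
        apply hMc.2
        exact lt_of_eq_of_lt hcm.symm ((Subgroup.comap_lt_comap_of_surjective hπ).2 hX)
    · constructor
      · intro X Y hXY
        apply inj
        have := hM.1 (X.comap π) (Y.comap π) (Subgroup.comap_mono hXY)
        rw [Subgroup.comap_inf, csup, csup, Subgroup.comap_inf, hcm]
        exact this
      · intro X Y hXY
        apply inj
        have := hM.2 (X.comap π) (Y.comap π) (hcm.symm.le.trans (Subgroup.comap_mono hXY))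
        rw [Subgroup.comap_inf, csup, csup, Subgroup.comap_inf, hcm]
        exact this
    · intro h
      exact hn (hcm ▸ h.comap π)
    · rw [eq_bot_iff]
      have h1 : ((M.map π).normalCore.comap π) ≤ N := by
        refine Subgroup.normal_le_normalCore.2 ?_
        conv_rhs => rw [← hcm]
        exact Subgroup.comap_mono (Subgroup.normalCore_le _)
      have h2 := (Subgroup.map_eq_bot_iff (f := π) _).2 (h1.trans hker.symm.le)
      rw [Subgroup.map_comap_eq_self_of_surjective hπ] at h2
      exact h2.le
  exact (sInf_le ⟨M.normalCore_normal, hU⟩ : fResidual U1 G ≤ N).trans hNM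

theorem exists_step {G : Type u} [Group G] [Finite G] {M : Subgroup G}
    (hM : IsModularSubgroup M) (hMt : M ≠ ⊤) :
    ∃ N : Subgroup G, M ≤ N ∧ N ≠ ⊤ ∧ (N.Normal ∨ fResidual U1 G ≤ N) := by
  obtain ⟨N, hMN, hN⟩ := (Set.toFinite {S : Subgroup G | IsModularSubgroup S ∧ S ≠ ⊤}).exists_le_maximal
    (show M ∈ {S : Subgroup G | IsModularSubgroup S ∧ S ≠ ⊤} from ⟨hM, hMt⟩)
  refine ⟨N, hMN, hN.prop.2, ?_⟩
  by_cases hn : N.Normal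
  · exact Or.inl hn
  · refine normal_or_residual_of_coatom (coatom_of_maximal_modular hN.prop.1 ?_ hn) hN.prop.1
    intro S hS hNS
    by_contra h
    exact hN.not_gt (show S ∈ {S : Subgroup G | IsModularSubgroup S ∧ S ≠ ⊤} from ⟨hS, h⟩) hNS

theorem KSubnormal.trans' {F : ∀ (G : Type u) [Group G], Prop} {G : Type u} [Group G]
    {H K L : Subgroup G} (h1 : KSubnormal F H K) (h2 : KSubnormal F K L) : KSubnormal F H L := by
  induction h2 with
  | refl => exact h1
  | step _ hle h ih => exact KSubnormal.step ih hle h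

/-- Modularity of `K` in `L` restricts to intermediate subgroups. -/
theorem modular_restrict {G : Type u} [Group G] {K N L : Subgroup G} (hKN : K ≤ N) (hNL : N ≤ L)
    (h : IsModularSubgroup (K.subgroupOf L)) : IsModularSubgroup (K.subgroupOf N) := by
  let ι : N →* L := Subgroup.inclusion hNL
  have hι : Function.Injective ι := Subgroup.inclusion_injective hNL
  have inj := Subgroup.map_injective hι
  have hK : (K.subgroupOf N).map ι = K.subgroupOf L := by
    ext x
    constructor
    · rintro ⟨y, hy, rfl⟩
      exact hy
    · intro hx
      exact ⟨⟨x, hKN hx⟩, hx, rfl⟩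
  have minf : ∀ X Y : Subgroup N, (X ⊓ Y).map ι = X.map ι ⊓ Y.map ι :=
    fun X Y => Subgroup.map_inf X Y ι hι
  constructor
  · intro X Y hXY
    apply inj
    rw [minf, Subgroup.map_sup, Subgroup.map_sup, minf, hK]
    exact h.1 _ _ (Subgroup.map_mono hXY)
  · intro X Y hXY
    apply inj
    rw [minf, Subgroup.map_sup, Subgroup.map_sup, minf, hK]
    exact h.2 _ _ (hK ▸ Subgroup.map_mono hXY)

theorem ksubnormal_of_modular {G : Type u} [Group G] [Finite G] (n : ℕ) :
    ∀ K L : Subgroup G, Nat.card L = n → K ≤ L → IsModularSubgroup (K.subgroupOf L) →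
      KSubnormal U1 K L := by
  induction n using Nat.strong_induction_on with
  | _ n ih =>
  intro K L hn hKL hmod
  by_cases hK : K.subgroupOf L = ⊤
  · rw [Subgroup.subgroupOf_eq_top] at hK
    obtain rfl := le_antisymm hKL hK
    exact KSubnormal.refl _
  obtain ⟨N, hKN, hNt, hN⟩ := exists_step hmod hK
  have hNN : (N.map L.subtype).subgroupOf L = N :=
    Subgroup.comap_map_eq_self_of_injective L.subtype_injective N
  have hNL : N.map L.subtype ≤ L := Subgroup.map_subtype_le N
  have hKN' : K ≤ N.map L.subtype := by
    intro x hx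
    exact ⟨⟨x, hKL hx⟩, hKN hx, rfl⟩
  have hlt : Nat.card (N.map L.subtype) < n := by
    rw [← hn]
    refine lt_of_le_of_ne (Subgroup.card_le_of_le hNL) ?_
    intro h
    have h2 := Subgroup.eq_of_le_of_card_ge hNL h.ge
    rw [h2, Subgroup.subgroupOf_self] at hNN
    exact hNt hNN.symm
  refine KSubnormal.step (ih _ hlt K _ rfl hKN' (modular_restrict hKN' hNL hmod)) hNL ?_
  rw [hNN]
  exact hN

/-- Every submodular subgroup is K𝔘₁-subnormal. -/
theorem stmt10 {G : Type u} [Group G] [Finite G] {H : Subgroup G}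
    (h : Submodular H ⊤) : KSubnormal U1 H ⊤ := by
  have key : ∀ K : Subgroup G, Submodular H K → KSubnormal U1 H K := by
    intro K hK
    induction hK with
    | refl => exact KSubnormal.refl _
    | step _ hle hm ih => exact ih.trans' (ksubnormal_of_modular _ _ _ rfl hle hm)
  exact key _ h
end

section
/- If A is a solvable submodular subgroup of a finite group G, then A is contained in the solvable radical of G; consequently, ⟨A, B⟩ is solvable for every solvable subgroup B of G. -/
universe u

section Lattice
variable {G : Type u} [Group G]

/-- Ambient version of modularity inside a subgroup. -/
theorem modular_subgroupOf {M : Subgroup G} (hM : IsModularSubgroup M) (K : Subgroup G) :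
    IsModularSubgroup (M.subgroupOf K) := by
  have inj : Function.Injective (Subgroup.map K.subtype) :=
    Subgroup.map_injective K.subtype_injective
  have minf : ∀ A B : Subgroup K, (A ⊓ B).map K.subtype = A.map K.subtype ⊓ B.map K.subtype :=
    fun A B => Subgroup.map_inf _ _ _ K.subtype_injective
  have mM : (M.subgroupOf K).map K.subtype = M ⊓ K := Subgroup.subgroupOf_map_subtype M K
  have mle : ∀ A : Subgroup K, A.map K.subtype ≤ K := Subgroup.map_subtype_le
  have key : ∀ A : Subgroup G, A ≤ K → A ⊔ (M ⊓ K) = (A ⊔ M) ⊓ K := fun A hA => (hM.1 A K hA).symm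
  constructor
  · intro X Y hXY
    apply inj
    have hXY' : X.map K.subtype ≤ Y.map K.subtype := Subgroup.map_mono hXY
    rw [minf, Subgroup.map_sup, Subgroup.map_sup, minf, mM]
    rw [key _ (mle X), inf_assoc, inf_eq_right.2 (mle Y), inf_assoc, inf_eq_right.2 (mle Y)]
    exact hM.1 _ _ hXY'
  · intro X Y hMY
    apply inj
    have hMY' : M ⊓ K ≤ Y.map K.subtype := mM ▸ Subgroup.map_mono hMY
    rw [minf, Subgroup.map_sup, Subgroup.map_sup, minf, mM]
    have hX := mle X
    have hY := mle Y
    generalize X.map K.subtype = A at *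
    generalize Y.map K.subtype = B at *
    have hB : (B ⊔ M) ⊓ K = B := by rw [← key B hY]; exact sup_eq_left.2 hMY'
    have hAB : A ⊓ (B ⊔ M) = A ⊓ B := by
      conv_rhs => rw [← hB]
      rw [inf_comm (B ⊔ M) K, ← inf_assoc, inf_eq_left.2 hX]
    rw [sup_comm, key A hX, sup_comm (M ⊓ K), key _ (inf_le_left.trans hX), ← hAB,
      sup_comm (A ⊓ (B ⊔ M)) M, ← hM.2 A (B ⊔ M) le_sup_right, inf_assoc, inf_eq_right.2 hY,
      inf_assoc, hB, sup_comm A M]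

theorem modular_sup {M N : Subgroup G} (hM : IsModularSubgroup M) (hN : IsModularSubgroup N) :
    IsModularSubgroup (M ⊔ N) := by
  constructor
  · intro X Z hXZ
    apply le_antisymm
    · set X' := X ⊔ ((M ⊔ N) ⊓ Z) with hX'
      have hX'Z : X' ≤ Z := sup_le hXZ inf_le_right
      have h1 : (X' ⊔ M) ⊓ Z = X' := by
        rw [hM.1 X' Z hX'Z]
        exact sup_eq_left.2 ((inf_le_inf_right _ le_sup_left).trans le_sup_right)
      have h2 : N ⊓ (Z ⊔ M) ≤ X' ⊔ M := by
        calc N ⊓ (Z ⊔ M) ≤ (M ⊔ Z) ⊓ (M ⊔ N) :=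
              le_inf (inf_le_right.trans (sup_comm Z M).le) (inf_le_left.trans le_sup_right)
          _ = M ⊔ (Z ⊓ (M ⊔ N)) := hM.2 _ _ le_sup_left
          _ ≤ X' ⊔ M := sup_le le_sup_right
              ((inf_comm Z (M ⊔ N)).le.trans (le_sup_right.trans le_sup_left))
      have h3 : (X' ⊔ M ⊔ N) ⊓ (Z ⊔ M) = X' ⊔ M := by
        rw [hN.1 (X' ⊔ M) (Z ⊔ M) (sup_le_sup_right hX'Z _)]
        exact sup_eq_left.2 h2
      calc (X ⊔ (M ⊔ N)) ⊓ Z ≤ ((X' ⊔ M ⊔ N) ⊓ (Z ⊔ M)) ⊓ Z := by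
            refine le_inf (le_inf ?_ ?_) inf_le_right
            · rw [← sup_assoc]
              exact inf_le_left.trans (sup_le_sup_right (sup_le_sup_right le_sup_left _) _)
            · exact inf_le_right.trans le_sup_left
        _ = X' := by rw [h3, h1]
    · exact le_inf (sup_le_sup_left inf_le_left _) (sup_le hXZ inf_le_right)
  · intro X Z h
    rw [sup_assoc, hM.2 _ Z (le_sup_left.trans h), hN.2 _ Z (le_sup_right.trans h), sup_assoc]

theorem modular_map_equiv {H : Type u} [Group H] (e : G ≃* H) {M : Subgroup G}
    (hM : IsModularSubgroup M) : IsModularSubgroup (M.map e.toMonoidHom) := by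
  set f := e.mapSubgroup with hf
  have hfM : M.map e.toMonoidHom = f M := rfl
  rw [hfM]
  constructor
  · intro X Y hXY
    obtain ⟨X, rfl⟩ := f.surjective X
    obtain ⟨Y, rfl⟩ := f.surjective Y
    rw [← map_sup, ← map_inf, ← map_inf, ← map_sup, hM.1 X Y (f.le_iff_le.1 hXY)]
  · intro X Y hXY
    obtain ⟨X, rfl⟩ := f.surjective X
    obtain ⟨Y, rfl⟩ := f.surjective Y
    rw [← map_sup, ← map_inf, ← map_inf, ← map_sup, hM.2 X Y (f.le_iff_le.1 hXY)]

/-- `M` meets every subgroup in itself or in a maximal subgroup. -/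
def StarSub (M : Subgroup G) : Prop :=
  ∀ X Y : Subgroup G, X ⊓ M ≤ Y → Y ≤ X → Y = X ⊓ M ∨ Y = X

theorem star_of_coatom {M : Subgroup G} (hM : IsModularSubgroup M) (hc : IsCoatom M) :
    StarSub M := by
  intro X Y h1 h2
  have h := hM.1 Y X h2
  rw [inf_comm M X, sup_eq_left.2 h1] at h
  rcases eq_or_ne (Y ⊔ M) M with e | e
  · left; rw [← h, e, inf_comm]
  · right
    have : Y ⊔ M = ⊤ := hc.2 _ (lt_of_le_of_ne le_sup_right e.symm)
    rw [← h, this, top_inf_eq]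

theorem star_map_equiv {H : Type u} [Group H] (e : G ≃* H) {M : Subgroup G}
    (hM : StarSub M) : StarSub (M.map e.toMonoidHom) := by
  set f := e.mapSubgroup with hf
  have hfM : M.map e.toMonoidHom = f M := rfl
  rw [hfM]
  intro X Y h1 h2
  obtain ⟨X, rfl⟩ := f.surjective X
  obtain ⟨Y, rfl⟩ := f.surjective Y
  rw [← map_inf] at h1 ⊢
  rcases hM X Y (f.le_iff_le.1 h1) (f.le_iff_le.1 h2) with h | h
  · left; rw [← h]
  · right; rw [← h]

theorem star_subgroupOf {M : Subgroup G} (hM : StarSub M) (K : Subgroup G) :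
    StarSub (M.subgroupOf K) := by
  intro X Y h1 h2
  have inj : Function.Injective (Subgroup.map K.subtype) :=
    Subgroup.map_injective K.subtype_injective
  have e : (X ⊓ M.subgroupOf K).map K.subtype = X.map K.subtype ⊓ M := by
    rw [Subgroup.map_inf _ _ _ K.subtype_injective, Subgroup.subgroupOf_map_subtype,
      inf_comm M K, ← inf_assoc, inf_eq_left.2 (Subgroup.map_subtype_le X)]
  rcases hM (X.map K.subtype) (Y.map K.subtype) (e ▸ Subgroup.map_mono h1)
    (Subgroup.map_mono h2) with h | h
  · left; exact inj (h.trans e.symm)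
  · right; exact inj h

theorem star_map_quot {M C : Subgroup G} [C.Normal] (hC : C ≤ M) (hM : StarSub M) :
    StarSub (M.map (QuotientGroup.mk' C)) := by
  intro X Y h1 h2
  have sur := QuotientGroup.mk'_surjective C
  have inj : Function.Injective (Subgroup.comap (QuotientGroup.mk' C)) :=
    Subgroup.comap_injective sur
  have e : (M.map (QuotientGroup.mk' C)).comap (QuotientGroup.mk' C) = M := by
    rw [Subgroup.comap_map_eq, QuotientGroup.ker_mk', sup_eq_left.2 hC]
  have e2 : (X ⊓ M.map (QuotientGroup.mk' C)).comap (QuotientGroup.mk' C)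
      = X.comap (QuotientGroup.mk' C) ⊓ M := by
    rw [Subgroup.comap_inf, e]
  rcases hM (X.comap (QuotientGroup.mk' C)) (Y.comap (QuotientGroup.mk' C))
    (e2 ▸ Subgroup.comap_mono h1) (Subgroup.comap_mono h2) with h | h
  · left; exact inj (h.trans e2.symm)
  · right; exact inj h

end Lattice
section StarSolvable

theorem star_coatom {G : Type u} [Group G] {M : Subgroup G} (hM : StarSub M) {P : Subgroup G}
    (h : ¬ P ≤ M) : IsCoatom (M.subgroupOf P) := by
  refine ⟨fun e => h (Subgroup.subgroupOf_eq_top.1 e), fun Y hY => ?_⟩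
  have hs := star_subgroupOf hM P ⊤ Y (by rw [top_inf_eq]; exact hY.le) le_top
  rw [top_inf_eq] at hs
  exact hs.resolve_left hY.ne'

theorem pgroup_coatom {P : Type u} [Group P] [Finite P] {p : ℕ} [hp : Fact p.Prime]
    (hP : IsPGroup p P) {V : Subgroup P} (hV : IsCoatom V) : V.Normal ∧ V.index = p := by
  have hnil : Group.IsNilpotent P := hP.isNilpotent
  refine ⟨Subgroup.NormalizerCondition.normal_of_coatom V Group.normalizerCondition_of_isNilpotent
    hV, ?_⟩
  obtain ⟨n, hn⟩ := IsPGroup.iff_card.1 hP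
  obtain ⟨k, hk⟩ := IsPGroup.iff_card.1 (hP.to_subgroup V)
  obtain ⟨j, hj⟩ := hP.index V
  have hmul := V.card_mul_index
  rw [hk, hj, hn, ← pow_add] at hmul
  have hkj : k + j = n := Nat.pow_right_injective hp.1.two_le hmul
  have hj0 : j ≠ 0 := by
    rintro rfl
    exact hV.1 (Subgroup.index_eq_one.1 (by simpa using hj))
  obtain ⟨K, hK, hVK⟩ := Sylow.exists_subgroup_card_pow_succ (p := p) (n := k)
    (hn ▸ pow_dvd_pow p (by omega)) hk
  have hKV : K ≠ V := by
    rintro rfl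
    rw [hk] at hK
    have := Nat.pow_right_injective hp.1.two_le hK
    omega
  have hKt : K = ⊤ := hV.2 _ (lt_of_le_of_ne hVK hKV.symm)
  rw [hKt, Subgroup.card_top, hn] at hK
  have := Nat.pow_right_injective hp.1.two_le hK
  have : j = 1 := by omega
  rw [hj, this, pow_one]

theorem comm_mem_of_index_prime {P : Type u} [Group P] [Finite P] {p : ℕ} [hp : Fact p.Prime]
    {V : Subgroup P} [V.Normal] (h : V.index = p) (x y : P) : x * y * x⁻¹ * y⁻¹ ∈ V := by
  have hc : IsCyclic (P ⧸ V) := isCyclic_of_prime_card (p := p) h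
  have : ∀ a b : P ⧸ V, a * b = b * a := by
    let := hc.commGroup
    exact mul_comm
  rw [← QuotientGroup.eq_one_iff]
  change (x : P ⧸ V) * y * (x : P ⧸ V)⁻¹ * (y : P ⧸ V)⁻¹ = 1
  rw [this (x : P ⧸ V) y]
  group

/-- A normal subgroup of smallest prime order is central. -/
theorem central_of_smallest {G : Type u} [Group G] [Finite G] {p : ℕ} [hp : Fact p.Prime]
    (hmin : ∀ q : ℕ, q.Prime → q ∣ Nat.card G → p ≤ q) {N : Subgroup G} [N.Normal]
    (hN : Nat.card N = p) (x : G) (hx : x ∈ N) (y : G) : y * x * y⁻¹ = x := by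
  have hc : IsCyclic N := isCyclic_of_prime_card (p := p) hN
  have hcard : Nat.card (MulAut N) = p - 1 := by
    rw [IsCyclic.card_mulAut, hN, Nat.totient_prime hp.1]
  have hfin : Finite (MulAut N) := Nat.finite_of_card_ne_zero (by
    rw [hcard]; have := hp.1.two_le; omega)
  have h1 : orderOf (MulAut.conjNormal y : MulAut N) ∣ p - 1 := hcard ▸ orderOf_dvd_natCard _
  have h2 : orderOf (MulAut.conjNormal y : MulAut N) ∣ Nat.card G :=
    (orderOf_map_dvd _ y).trans (orderOf_dvd_natCard y)
  have h3 : orderOf (MulAut.conjNormal y : MulAut N) = 1 := by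
    by_contra hne
    obtain ⟨q, hq, hqd⟩ := Nat.exists_prime_and_dvd hne
    have h4 := hmin q hq (hqd.trans h2)
    have h5 := Nat.le_of_dvd (by have := hp.1.two_le; omega) (hqd.trans h1)
    have := hp.1.two_le
    omega
  rw [orderOf_eq_one_iff] at h3
  have := MulAut.conjNormal_apply (H := N) y ⟨x, hx⟩
  rw [h3] at this
  exact this.symm

theorem star_central {G : Type u} [Group G] [Finite G] {p : ℕ} [hp : Fact p.Prime]
    (hmin : ∀ q : ℕ, q.Prime → q ∣ Nat.card G → p ≤ q) {P : Subgroup G} [hPn : P.Normal]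
    (hP : IsPGroup p P) (hcomm : ∀ x ∈ P, ∀ y ∈ P, x * y = y * x) {M : Subgroup G}
    (hM : StarSub M) (x : G) (hx : x ∈ P) (y : G) : y * x * y⁻¹ * x⁻¹ ∈ M := by
  by_cases hPM : P ≤ M
  · exact hPM (P.mul_mem (hPn.conj_mem x hx y) (P.inv_mem hx))
  have htop : P ⊔ M = ⊤ := by
    rcases hM ⊤ (P ⊔ M) (by rw [top_inf_eq]; exact le_sup_right) le_top with h | h
    · rw [top_inf_eq] at h
      exact absurd (h ▸ le_sup_left) hPM
    · exact h
  have hVn : (P ⊓ M).Normal := by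
    rw [← Subgroup.normalizer_eq_top_iff, ← top_le_iff, ← htop]
    refine sup_le ?_ ?_
    · rw [Subgroup.le_normalizer_iff]
      rintro a ha b ⟨hb, hb'⟩
      rw [hcomm a ha b hb, mul_inv_cancel_right]
      exact ⟨hb, hb'⟩
    · rw [Subgroup.le_normalizer_iff]
      rintro a ha b ⟨hb, hb'⟩
      exact ⟨hPn.conj_mem b hb a, M.mul_mem (M.mul_mem ha hb') (M.inv_mem ha)⟩
  set V := P ⊓ M with hV
  have hidx : (M.subgroupOf P).index = p := (pgroup_coatom hP (star_coatom hM hPM)).2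
  have hcardP : Nat.card (P.map (QuotientGroup.mk' V)) = p := by
    have h1 : (M.subgroupOf P) = (QuotientGroup.mk' V).ker.subgroupOf P := by
      rw [QuotientGroup.ker_mk', hV, Subgroup.inf_subgroupOf_left]
    rw [← hidx, h1]
    change _ = Subgroup.relIndex _ _
    rw [Subgroup.relIndex_ker]
  have : (P.map (QuotientGroup.mk' V)).Normal := hPn.map _ (QuotientGroup.mk'_surjective V)
  have key := central_of_smallest (p := p) (G := G ⧸ V)
    (fun q hq hqd => hmin q hq (hqd.trans (Subgroup.card_quotient_dvd_card V)))
    hcardP (x : G ⧸ V) ⟨x, hx, rfl⟩ (y : G ⧸ V)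
  have : y * x * y⁻¹ * x⁻¹ ∈ V := by
    rw [← QuotientGroup.eq_one_iff]
    change (y : G ⧸ V) * x * (y : G ⧸ V)⁻¹ * (x : G ⧸ V)⁻¹ = 1
    rw [key, mul_inv_cancel]
  exact this.2

theorem star_solvable_aux (n : ℕ) : ∀ (G : Type u) [Group G] [Finite G],
    Nat.card G = n → (∀ x : G, (∀ M : Subgroup G, StarSub M → x ∈ M) → x = 1) →
    Group.IsSolvable G := by
  induction n using Nat.strong_induction_on with
  | _ n ih =>
    intro G _ _ hn hG
    by_cases h1 : Nat.card G = 1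
    · have := (Nat.card_eq_one_iff_unique.mp h1).1
      infer_instance
    set p := (Nat.card G).minFac with hp
    have hpp : Fact p.Prime := ⟨Nat.minFac_prime h1⟩
    have hmin : ∀ q : ℕ, q.Prime → q ∣ Nat.card G → p ≤ q := fun q hq hd =>
      Nat.minFac_le_of_dvd hq.two_le hd
    obtain ⟨P⟩ : Nonempty (Sylow p G) := inferInstance
    have hcomm : ∀ x ∈ (P : Subgroup G), ∀ y ∈ (P : Subgroup G), x * y = y * x := by
      intro x hx y hy
      have : x * y * x⁻¹ * y⁻¹ = 1 := by
        apply hG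
        intro M hM
        by_cases hPM : (P : Subgroup G) ≤ M
        · exact hPM (mul_mem (mul_mem (mul_mem hx hy) (inv_mem hx)) (inv_mem hy))
        · obtain ⟨hnor, hidx⟩ := pgroup_coatom P.2 (star_coatom hM hPM)
          exact comm_mem_of_index_prime hidx (⟨x, hx⟩ : P) ⟨y, hy⟩
      rw [mul_inv_eq_one, mul_inv_eq_iff_eq_mul] at this
      exact this
    have hcent : Subgroup.normalizer (P : Set G) ≤ Subgroup.centralizer (P : Set G) := by
      intro y hy x hx
      have : y * x * y⁻¹ * x⁻¹ = 1 := by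
        apply hG
        intro M hM
        have hPN : (P : Subgroup G) ≤ Subgroup.normalizer (P : Set G) := Subgroup.le_normalizer
        have hPn : ((P : Subgroup G).subgroupOf (Subgroup.normalizer (P : Set G))).Normal :=
          Subgroup.normal_subgroupOf_of_le_normalizer le_rfl
        exact star_central (p := p) (G := Subgroup.normalizer (P : Set G))
          (fun q hq hqd => hmin q hq (hqd.trans (Subgroup.card_subgroup_dvd_card _)))
          (P := (P : Subgroup G).subgroupOf (Subgroup.normalizer (P : Set G)))
          (P.2.comap_of_injective _ (Subgroup.subtype_injective _))
          (fun a ha b hb => Subtype.ext (hcomm a ha b hb))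
          (star_subgroupOf hM _) ⟨x, hPN hx⟩ hx ⟨y, hy⟩
      rw [mul_inv_eq_one, mul_inv_eq_iff_eq_mul] at this
      exact this.symm
    set f := MonoidHom.transferSylow P hcent with hf
    have hcompl := MonoidHom.ker_transferSylow_isComplement' P hcent
    have hPcard : 1 < Nat.card P := by
      have hd : p ∣ Nat.card P := P.dvd_card_of_dvd_card (Nat.minFac_dvd _)
      exact lt_of_lt_of_le hpp.1.one_lt (Nat.le_of_dvd Nat.card_pos hd)
    have hlt : Nat.card f.ker < n := by
      have := hcompl.card_mul_card
      have h0 : 0 < Nat.card f.ker := Nat.card_pos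
      rw [← hn, ← this]
      exact lt_mul_of_one_lt_right h0 hPcard
    have hKs : Group.IsSolvable f.ker := ih _ hlt f.ker rfl (by
      intro x hx
      apply Subtype.ext
      apply hG
      intro M hM
      exact hx _ (star_subgroupOf hM f.ker))
    have hPs : Group.IsSolvable P := Group.isSolvable_of_comm
      (fun a b => Subtype.ext (hcomm a a.2 b b.2))
    exact Group.isSolvable_of_ker_le_range f.ker.subtype f (by simp)

/-- A modular maximal subgroup has solvable quotient by its core. -/
theorem coatom_solvable {G : Type u} [Group G] [Finite G] {M : Subgroup G}
    (hM : IsModularSubgroup M) (hc : IsCoatom M) : Group.IsSolvable (G ⧸ M.normalCore) := by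
  refine star_solvable_aux _ _ rfl ?_
  intro x
  obtain ⟨x, rfl⟩ := QuotientGroup.mk'_surjective _ x
  intro hx
  rw [QuotientGroup.mk'_apply, QuotientGroup.eq_one_iff]
  intro g
  have hs := star_map_equiv (MulAut.conj g⁻¹) (star_of_coatom hM hc)
  have hle : M.normalCore ≤ M.map (MulAut.conj g⁻¹).toMonoidHom := by
    intro c hcc
    refine ⟨g * c * g⁻¹, hcc g, ?_⟩
    simp [mul_assoc]
  have h := hx _ (star_map_quot hle hs)
  rw [← Subgroup.mem_comap, Subgroup.comap_map_eq, QuotientGroup.ker_mk', sup_eq_left.2 hle] at h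
  obtain ⟨m, hm, rfl⟩ := h
  simpa [mul_assoc] using hm

end StarSolvable
section NonMaximal
variable {G : Type u} [Group G]

theorem mem_of_pow_coprime {M : Subgroup G} {y : G} {a b : ℤ} (h : IsCoprime a b)
    (ha : y ^ a ∈ M) (hb : y ^ b ∈ M) : y ∈ M := by
  obtain ⟨u, v, huv⟩ := h
  have : y = (y ^ a) ^ u * (y ^ b) ^ v := by
    rw [← zpow_mul, ← zpow_mul, ← zpow_add, mul_comm a, mul_comm b, huv, zpow_one]
  rw [this]
  exact M.mul_mem (M.zpow_mem ha u) (M.zpow_mem hb v)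

theorem le_zpowers_pow {H : Subgroup G} {g : G} {p k : ℕ} (hp : p.Prime) (hg : g ^ (p ^ k) = 1)
    (hH : H ≤ Subgroup.zpowers g) (hgH : g ∉ H) : H ≤ Subgroup.zpowers (g ^ p) := by
  intro x hx
  obtain ⟨z, rfl⟩ := Subgroup.mem_zpowers_iff.1 (hH hx)
  by_cases hz : (p : ℤ) ∣ z
  · obtain ⟨w, rfl⟩ := hz
    refine Subgroup.mem_zpowers_iff.2 ⟨w, ?_⟩
    rw [zpow_mul, zpow_natCast]
  · exfalso
    apply hgH
    have hcop : IsCoprime ((p ^ k : ℕ) : ℤ) z := by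
      push_cast
      exact IsCoprime.pow_left ((Nat.prime_iff_prime_int.1 hp).coprime_iff_not_dvd.2 hz)
    refine mem_of_pow_coprime hcop ?_ hx
    rw [zpow_natCast, hg]
    exact H.one_mem

theorem normalizes_of_proper {M : Subgroup G} (hM : IsModularSubgroup M)
    (hmax : ∀ K : Subgroup G, IsModularSubgroup K → M < K → K = ⊤) {U : Subgroup G}
    (hMU : M ≤ U) (hU : U ≠ ⊤) : U ≤ Subgroup.normalizer (M : Set G) := by
  rw [Subgroup.le_normalizer_iff]
  intro g hg n hn
  have hmod := modular_sup hM (modular_map_equiv (MulAut.conj g) hM)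
  have hle : M ⊔ M.map (MulAut.conj g).toMonoidHom ≤ U := by
    refine sup_le hMU ?_
    rintro _ ⟨m, hm, rfl⟩
    exact U.mul_mem (U.mul_mem hg (hMU hm)) (U.inv_mem hg)
  have hmem : g * n * g⁻¹ ∈ M ⊔ M.map (MulAut.conj g).toMonoidHom :=
    (le_sup_right : M.map (MulAut.conj g).toMonoidHom ≤ _) ⟨n, hn, rfl⟩
  by_contra hnot
  have hlt : M < M ⊔ M.map (MulAut.conj g).toMonoidHom :=
    lt_of_le_of_ne le_sup_left (fun e => hnot (by rw [e]; exact hmem))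
  exact hU (top_le_iff.1 (hmax _ hmod hlt ▸ hle))

theorem cyc_step {M : Subgroup G} (hM : IsModularSubgroup M) {g : G} {p k : ℕ} (hp : p.Prime)
    (hg : g ^ (p ^ k) = 1) (hgM : g ∉ M) (htop : M ⊔ Subgroup.zpowers g = ⊤)
    (hnt : g ∉ Subgroup.zpowers (g ^ p)) :
    (∀ U : Subgroup G, M ≤ U → U ≠ ⊤ → U ≤ M ⊔ Subgroup.zpowers (g ^ p)) ∧
      M ⊔ Subgroup.zpowers (g ^ p) ≠ ⊤ := by
  constructor
  · intro U hMU hU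
    have h := hM.2 (Subgroup.zpowers g) U hMU
    rw [htop, top_inf_eq] at h
    have hgU : g ∉ U := by
      intro hgU
      apply hU
      rw [← top_le_iff, ← htop]
      exact sup_le hMU ((Subgroup.zpowers_le).2 hgU)
    calc U = M ⊔ Subgroup.zpowers g ⊓ U := h
      _ ≤ _ := sup_le_sup_left
        (le_zpowers_pow hp hg inf_le_left (fun h => hgU h.2)) _
  · intro ht
    have hle : Subgroup.zpowers (g ^ p) ≤ Subgroup.zpowers g :=
      (Subgroup.zpowers_le).2 (Subgroup.pow_mem _ (Subgroup.mem_zpowers g) p)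
    have h := hM.1 _ _ hle
    rw [sup_comm, ht, top_inf_eq] at h
    have h2 : M ⊓ Subgroup.zpowers g ≤ Subgroup.zpowers (g ^ p) :=
      le_zpowers_pow hp hg inf_le_right (fun h => hgM h.1)
    rw [sup_eq_left.2 h2] at h
    exact hnt (h ▸ Subgroup.mem_zpowers g)

theorem not_mem_zpowers_pow {M : Subgroup G} {g : G} {p k : ℕ}
    (hg : g ^ (p ^ k) = 1) (hgM : g ∉ M) : g ∉ Subgroup.zpowers (g ^ p) := by
  intro h
  obtain ⟨z, hz⟩ := Subgroup.mem_zpowers_iff.1 h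
  have key : ∀ n : ℕ, g ∈ Subgroup.zpowers (g ^ (p ^ n)) := by
    intro n
    induction n with
    | zero => simp
    | succ n ih =>
      obtain ⟨w, hw⟩ := Subgroup.mem_zpowers_iff.1 ih
      refine Subgroup.mem_zpowers_iff.2 ⟨z * w, ?_⟩
      calc (g ^ p ^ (n + 1)) ^ (z * w) = (((g ^ p) ^ z) ^ (p ^ n)) ^ w := by
            simp only [← zpow_natCast, ← zpow_mul]
            congr 1
            push_cast
            ring
        _ = g := by rw [hz, hw]
  have := key k
  rw [hg, Subgroup.zpowers_one_eq_bot, Subgroup.mem_bot] at this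
  exact hgM (this ▸ M.one_mem)

theorem pow_mul_mem {M : Subgroup G} {m h : G} (hm : m ∈ M)
    (hh : h ∈ Subgroup.normalizer (M : Set G)) (n : ℕ) : (m * h) ^ n * (h ^ n)⁻¹ ∈ M := by
  induction n with
  | zero => simp
  | succ n ih =>
    have e : (m * h) ^ (n + 1) * (h ^ (n + 1))⁻¹
        = ((m * h) ^ n * (h ^ n)⁻¹) * (h ^ n * m * (h ^ n)⁻¹) := by
      rw [pow_succ, pow_succ h]
      group
    rw [e]
    exact M.mul_mem ih ((Subgroup.mem_normalizer_iff.1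
      (Subgroup.pow_mem _ hh n) m).1 hm)

theorem exists_not_mem_of_ne_top [Finite G] {L : Subgroup G} (hL : L ≠ ⊤) :
    ∃ (p k : ℕ) (g : G), p.Prime ∧ g ^ (p ^ k) = 1 ∧ g ∉ L := by
  have h1 : L.index ≠ 1 := fun h => hL (Subgroup.index_eq_one.1 h)
  obtain ⟨p, hp, hpd⟩ := Nat.exists_prime_and_dvd h1
  have : Fact p.Prime := ⟨hp⟩
  obtain ⟨P⟩ : Nonempty (Sylow p G) := inferInstance
  have hPL : ¬ (P : Subgroup G) ≤ L := fun h =>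
    P.not_dvd_index (hpd.trans (Subgroup.index_dvd_of_le h))
  obtain ⟨g, hgP, hgL⟩ := SetLike.not_le_iff_exists.1 hPL
  obtain ⟨k, hk⟩ := P.2 ⟨g, hgP⟩
  exact ⟨p, k, g, hp, congrArg Subtype.val hk, hgL⟩

theorem noncoatom_solvable [Finite G] {M : Subgroup G} (hM : IsModularSubgroup M)
    (hne : M ≠ ⊤) (hmax : ∀ K : Subgroup G, IsModularSubgroup K → M < K → K = ⊤)
    (hnc : ¬ IsCoatom M) (hnn : ¬ M.Normal) : Group.IsSolvable (G ⧸ M.normalCore) := by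
  have hL : Subgroup.normalizer (M : Set G) ≠ ⊤ := fun h =>
    hnn (Subgroup.normalizer_eq_top_iff.1 h)
  have hML : M ≤ Subgroup.normalizer (M : Set G) := Subgroup.le_normalizer
  have gen : ∀ g : G, g ∉ Subgroup.normalizer (M : Set G) → M ⊔ Subgroup.zpowers g = ⊤ := by
    intro g hg
    by_contra h
    exact hg (normalizes_of_proper hM hmax le_sup_left h
      ((le_sup_right : Subgroup.zpowers g ≤ _) (Subgroup.mem_zpowers g)))
  obtain ⟨p, k, g, hp, hg, hgL⟩ := exists_not_mem_of_ne_top hL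
  have hgM : g ∉ M := fun h => hgL (hML h)
  obtain ⟨c1, c2⟩ := cyc_step hM hp hg hgM (gen g hgL) (not_mem_zpowers_pow hg hgM)
  have hgpL : Subgroup.zpowers (g ^ p) ≤ Subgroup.normalizer (M : Set G) :=
    le_sup_right.trans (normalizes_of_proper hM hmax le_sup_left c2)
  have inL : ∀ (q j : ℕ) (y : G), q.Prime → q ≠ p → y ^ (q ^ j) = 1 →
      y ∈ Subgroup.normalizer (M : Set G) → y ∈ M := by
    intro q j y hq hqp hy hyL
    have hy' : y ∈ (↑(M ⊔ Subgroup.zpowers (g ^ p)) : Set G) := c1 _ hML hL hyL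
    rw [Subgroup.coe_mul_of_right_le_normalizer_left _ _ hgpL] at hy'
    obtain ⟨m, hm, h, hh, rfl⟩ := hy'
    have hhp : h ^ (p ^ k) = 1 := by
      obtain ⟨z, rfl⟩ := Subgroup.mem_zpowers_iff.1 hh
      have : ((g ^ p) ^ z) ^ p ^ k = ((g ^ (p ^ k)) ^ p) ^ z := by
        simp only [← zpow_natCast, ← zpow_mul]
        congr 1
        push_cast
        ring
      rw [this, hg, one_pow, one_zpow]
    have h1 := pow_mul_mem hm (hgpL hh) (p ^ k)
    rw [hhp, inv_one, mul_one] at h1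
    refine mem_of_pow_coprime (a := ((p ^ k : ℕ) : ℤ)) (b := ((q ^ j : ℕ) : ℤ)) ?_ ?_ ?_
    · exact Nat.isCoprime_iff_coprime.2 (Nat.Coprime.pow _ _ ((Nat.coprime_primes hp hq).2 hqp.symm))
    · rw [zpow_natCast]; exact h1
    · rw [zpow_natCast]
      exact (show (m * h) ^ q ^ j = 1 from hy) ▸ M.one_mem
  have inM : ∀ (q j : ℕ) (y : G), q.Prime → q ≠ p → y ^ (q ^ j) = 1 → y ∈ M := by
    intro q j y hq hqp hy
    by_cases hyL : y ∈ Subgroup.normalizer (M : Set G)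
    · exact inL q j y hq hqp hy hyL
    exfalso
    have hyM : y ∉ M := fun h => hyL (hML h)
    obtain ⟨d1, d2⟩ := cyc_step hM hq hy hyM (gen y hyL) (not_mem_zpowers_pow hy hyM)
    have hyq : y ^ q ∈ M := by
      refine inL q j _ hq hqp ?_ ?_
      · rw [← pow_mul, mul_comm, pow_mul, hy, one_pow]
      · exact normalizes_of_proper hM hmax le_sup_left d2
          ((le_sup_right : Subgroup.zpowers (y ^ q) ≤ _) (Subgroup.mem_zpowers _))
    apply hnc
    refine ⟨hne, fun U hU => ?_⟩
    by_contra hUt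
    have := d1 U hU.le hUt
    rw [sup_eq_left.2 ((Subgroup.zpowers_le).2 hyq)] at this
    exact absurd this (not_le_of_gt hU)
  have hidx : M.normalCore.index = p ^ M.normalCore.index.primeFactorsList.length := by
    apply Nat.eq_prime_pow_of_unique_prime_dvd Subgroup.FiniteIndex.index_ne_zero
    intro q hq hqd
    by_contra hqp
    have : Fact q.Prime := ⟨hq⟩
    obtain ⟨Q⟩ : Nonempty (Sylow q G) := inferInstance
    refine Q.not_dvd_index (hqd.trans (Subgroup.index_dvd_of_le ?_))
    intro y hyQ x
    obtain ⟨j, hj⟩ := Q.2 ⟨y, hyQ⟩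
    have hj' : y ^ q ^ j = 1 := congrArg Subtype.val hj
    refine inM q j _ hq hqp ?_
    rw [conj_pow, hj', mul_one, mul_inv_cancel]
  have : Fact p.Prime := ⟨hp⟩
  have hPG : IsPGroup p (G ⧸ M.normalCore) := IsPGroup.of_card hidx
  have := hPG.isNilpotent
  infer_instance

end NonMaximal
section Radical

theorem sup_solvable {G : Type u} [Group G] {N H : Subgroup G} [N.Normal]
    (hN : Group.IsSolvable N) (hH : Group.IsSolvable H) :
    Group.IsSolvable ↥(N ⊔ H) := by
  have h1 : Group.IsSolvable (H.map (QuotientGroup.mk' N)) :=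
    Group.isSolvable_of_surjective ((QuotientGroup.mk' N).subgroupMap_surjective H)
  have e : (N ⊔ H).map (QuotientGroup.mk' N) = H.map (QuotientGroup.mk' N) := by
    rw [Subgroup.map_sup, QuotientGroup.map_mk'_self, bot_sup_eq]
  rw [← e] at h1
  refine Group.isSolvable_of_ker_le_range (Subgroup.inclusion (le_sup_left : N ≤ N ⊔ H))
    ((QuotientGroup.mk' N).subgroupMap (N ⊔ H)) ?_
  intro x hx
  have hx' : QuotientGroup.mk' N (x : G) = 1 := congrArg Subtype.val hx
  rw [QuotientGroup.mk'_apply, QuotientGroup.eq_one_iff] at hx'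
  exact ⟨⟨x, hx'⟩, rfl⟩

theorem solvable_of_le {G : Type u} [Group G] {H K : Subgroup G} (h : H ≤ K)
    (hK : Group.IsSolvable K) : Group.IsSolvable H :=
  Group.isSolvable_of_isSolvable_injective (Subgroup.inclusion_injective h)

theorem solvRad_spec (G : Type u) [Group G] [Finite G] :
    (solvRad G).Normal ∧ Group.IsSolvable (solvRad G) := by
  set S := {N : Subgroup G | N.Normal ∧ IsSolvable ↥N} with hS
  have hne : S.Nonempty := ⟨⊥, inferInstance, (inferInstance : Group.IsSolvable _)⟩
  obtain ⟨N, hN⟩ := (Set.toFinite S).exists_maximal hne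
  have hNn : N.Normal := hN.prop.1
  have : solvRad G = N := by
    apply le_antisymm
    · refine sSup_le fun K hK => ?_
      have hKn : K.Normal := hK.1
      have hsup : N ⊔ K ∈ S := ⟨inferInstance, sup_solvable hN.prop.2 hK.2⟩
      exact le_sup_right.trans (hN.le_of_ge hsup le_sup_left)
    · exact le_sSup hN.prop
  rw [this]
  exact hN.prop

theorem le_solvRad {G : Type u} [Group G] {N : Subgroup G} (h : N.Normal)
    (hs : Group.IsSolvable N) : N ≤ solvRad G := le_sSup ⟨h, hs⟩

theorem map_solvable {G H : Type u} [Group G] [Group H] (f : G →* H) {N : Subgroup G}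
    (hN : Group.IsSolvable N) : Group.IsSolvable (N.map f) :=
  Group.isSolvable_of_surjective (f.subgroupMap_surjective N)

theorem solvRad_char (G : Type u) [Group G] [Finite G] : (solvRad G).Characteristic := by
  rw [Subgroup.characteristic_iff_map_le]
  intro φ
  exact le_solvRad ((solvRad_spec G).1.map _ φ.surjective) (map_solvable _ (solvRad_spec G).2)

/-- The solvable radical of a subgroup, as a subgroup of the ambient group. -/
def radIn {G : Type u} [Group G] (K : Subgroup G) : Subgroup G := (solvRad K).map K.subtype

theorem radIn_le {G : Type u} [Group G] (K : Subgroup G) : radIn K ≤ K :=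
  Subgroup.map_subtype_le _

theorem radIn_solvable {G : Type u} [Group G] [Finite G] (K : Subgroup G) :
    Group.IsSolvable (radIn K) := map_solvable _ (solvRad_spec K).2

theorem radIn_normalized {G : Type u} [Group G] [Finite G] (K : Subgroup G) :
    K ≤ Subgroup.normalizer (radIn K : Set G) := by
  rw [Subgroup.le_normalizer_iff]
  rintro g hg _ ⟨n, hn, rfl⟩
  exact ⟨⟨g, hg⟩ * n * ⟨g, hg⟩⁻¹, (solvRad_spec K).1.conj_mem n hn _, rfl⟩

theorem radIn_normal {G : Type u} [Group G] [Finite G] (K : Subgroup G) [K.Normal] :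
    (radIn K).Normal := by
  have := solvRad_char K
  exact ConjAct.normal_of_characteristic_of_normal

theorem le_radIn {G : Type u} [Group G] {N K : Subgroup G} (hNK : N ≤ K)
    (hn : K ≤ Subgroup.normalizer (N : Set G)) (hs : Group.IsSolvable N) : N ≤ radIn K := by
  have h1 : (N.subgroupOf K).Normal := Subgroup.normal_subgroupOf_of_le_normalizer hn
  have h2 : Group.IsSolvable (N.subgroupOf K) :=
    Group.isSolvable_of_isSolvable_injective (Subgroup.subgroupOfEquivOfLe hNK).injective
      (f := (Subgroup.subgroupOfEquivOfLe hNK).toMonoidHom)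
  intro x hx
  exact ⟨⟨x, hNK hx⟩, le_solvRad h1 h2 hx, rfl⟩

/-- The case where the quotient by the core is solvable. -/
theorem rad_core {G : Type u} [Group G] [Finite G] {K : Subgroup G}
    (h : Group.IsSolvable (G ⧸ K.normalCore)) : radIn K ≤ solvRad G := by
  set C := K.normalCore with hC
  have hCK : C ≤ K := Subgroup.normalCore_le K
  set A := radIn K with hA
  have hAC : A ⊓ C ≤ radIn C := by
    refine le_radIn inf_le_right ?_ (solvable_of_le inf_le_left (radIn_solvable K))
    rw [Subgroup.le_normalizer_iff]
    rintro c hc a ⟨ha, ha'⟩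
    exact ⟨(Subgroup.le_normalizer_iff.1 (radIn_normalized K)) c (hCK hc) a ha,
      C.mul_mem (C.mul_mem hc ha') (C.inv_mem hc)⟩
  have hRn : (radIn C).Normal := radIn_normal C
  set R := radIn C with hR
  have hCm : (C.map (QuotientGroup.mk' R)).Normal :=
    Subgroup.Normal.map inferInstance _ (QuotientGroup.mk'_surjective R)
  set T := (Subgroup.centralizer (C.map (QuotientGroup.mk' R) : Set (G ⧸ R))).comap
    (QuotientGroup.mk' R) with hT
  have hTn : T.Normal := Subgroup.Normal.comap inferInstance _
  have memT : ∀ t : G, t ∈ T ↔ ∀ c ∈ C, c⁻¹ * t⁻¹ * c * t ∈ R := by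
    intro t
    rw [hT, Subgroup.mem_comap, Subgroup.mem_centralizer_iff]
    constructor
    · intro h c hc
      have := h (QuotientGroup.mk' R c) ⟨c, hc, rfl⟩
      rw [← map_mul, ← map_mul, QuotientGroup.mk'_apply, QuotientGroup.mk'_apply, eq_comm,
        QuotientGroup.eq] at this
      simpa [mul_assoc] using this
    · rintro h _ ⟨c, hc, rfl⟩
      rw [← map_mul, ← map_mul, QuotientGroup.mk'_apply, QuotientGroup.mk'_apply, eq_comm,
        QuotientGroup.eq]
      simpa [mul_assoc] using h c hc
  have hAT : A ≤ T := by
    intro a ha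
    rw [memT]
    intro c hc
    apply hAC
    constructor
    · have h1 := (Subgroup.le_normalizer_iff.1 (radIn_normalized K)) c⁻¹ (K.inv_mem (hCK hc)) a⁻¹
        (A.inv_mem ha)
      rw [inv_inv] at h1
      exact A.mul_mem h1 ha
    · have h1 : a⁻¹ * c * a⁻¹⁻¹ ∈ C := (inferInstance : C.Normal).conj_mem c hc a⁻¹
      rw [inv_inv] at h1
      have := C.mul_mem (C.inv_mem hc) h1
      simpa [mul_assoc] using this
  have hTC : Group.IsSolvable ↥(T ⊓ C) := by
    have hRs : Group.IsSolvable R := radIn_solvable C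
    have hcom : Group.IsSolvable ((T ⊓ C).map (QuotientGroup.mk' R)) := by
      apply Group.isSolvable_of_comm
      rintro ⟨_, a, ha, rfl⟩ ⟨_, b, hb, rfl⟩
      apply Subtype.ext
      have h1 := Subgroup.mem_centralizer_iff.1 (Subgroup.mem_comap.1 ha.1)
        (QuotientGroup.mk' R b) ⟨b, hb.2, rfl⟩
      exact h1.symm
    refine Group.isSolvable_of_ker_le_range
      (Subgroup.inclusion (inf_le_right : R ⊓ (T ⊓ C) ≤ T ⊓ C))
      ((QuotientGroup.mk' R).subgroupMap (T ⊓ C)) ?_ (hG' := solvable_of_le inf_le_left hRs)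
    intro x hx
    have hx' : QuotientGroup.mk' R (x : G) = 1 := congrArg Subtype.val hx
    rw [QuotientGroup.mk'_apply, QuotientGroup.eq_one_iff] at hx'
    exact ⟨⟨x, hx', x.2⟩, rfl⟩
  have hTs : Group.IsSolvable T := by
    refine Group.isSolvable_of_ker_le_range (Subgroup.inclusion (inf_le_left : T ⊓ C ≤ T))
      ((QuotientGroup.mk' C).comp T.subtype) ?_
    intro x hx
    have hx' : QuotientGroup.mk' C (x : G) = 1 := hx
    rw [QuotientGroup.mk'_apply, QuotientGroup.eq_one_iff] at hx'
    exact ⟨⟨x, x.2, hx'⟩, rfl⟩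
  exact hAT.trans (le_solvRad hTn hTs)

theorem rad_maximal {G : Type u} [Group G] [Finite G] {M : Subgroup G} (hM : IsModularSubgroup M)
    (hne : M ≠ ⊤) (hmax : ∀ K : Subgroup G, IsModularSubgroup K → M < K → K = ⊤) :
    radIn M ≤ solvRad G := by
  by_cases hn : M.Normal
  · exact le_solvRad (radIn_normal M) (radIn_solvable M)
  by_cases hc : IsCoatom M
  · exact rad_core (coatom_solvable hM hc)
  · exact rad_core (noncoatom_solvable hM hne hmax hc hn)

/-- Passing from a statement inside `K` to the ambient group. -/
theorem radIn_transfer {G : Type u} [Group G] [Finite G] {M K : Subgroup G} (hMK : M ≤ K)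
    (h : radIn (M.subgroupOf K) ≤ solvRad K) : radIn M ≤ radIn K := by
  intro x hx
  have hxM := radIn_le M hx
  have hle : (radIn M).subgroupOf K ≤ radIn (M.subgroupOf K) := by
    apply le_radIn
    · exact fun y hy => radIn_le M hy
    · rw [Subgroup.le_normalizer_iff]
      intro a ha b hb
      exact (Subgroup.le_normalizer_iff.1 (radIn_normalized M)) a ha b hb
    · have hs := radIn_solvable M
      exact Group.isSolvable_of_isSolvable_injective
        (Subgroup.subgroupOfEquivOfLe ((radIn_le M).trans hMK)).injective
        (f := (Subgroup.subgroupOfEquivOfLe ((radIn_le M).trans hMK)).toMonoidHom)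
  exact ⟨⟨x, hMK hxM⟩, h (hle hx), rfl⟩

theorem rad_modular (n : ℕ) : ∀ (G : Type u) [Group G] [Finite G] (M : Subgroup G),
    Nat.card G = n → IsModularSubgroup M → radIn M ≤ solvRad G := by
  induction n using Nat.strong_induction_on with
  | _ n ih =>
    intro G _ _ M hn hM
    by_cases hne : M = ⊤
    · subst hne
      exact le_solvRad (radIn_normal ⊤) (radIn_solvable ⊤)
    set S := {K : Subgroup G | IsModularSubgroup K ∧ M ≤ K ∧ K ≠ ⊤} with hS
    obtain ⟨K, hK⟩ := (Set.toFinite S).exists_maximal ⟨M, hM, le_rfl, hne⟩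
    obtain ⟨hKm, hMK, hKt⟩ := hK.prop
    have hmax : ∀ L : Subgroup G, IsModularSubgroup L → K < L → L = ⊤ := by
      intro L hL hKL
      by_contra hLt
      exact absurd (hK.le_of_ge ⟨hL, hMK.trans hKL.le, hLt⟩ hKL.le) (not_le_of_gt hKL)
    have hlt : Nat.card K < n := by
      rw [← hn]
      refine lt_of_le_of_ne (Subgroup.card_le_card_group K) ?_
      exact fun e => hKt (Subgroup.eq_top_of_card_eq K e)
    exact (radIn_transfer hMK (ih _ hlt K (M.subgroupOf K) rfl (modular_subgroupOf hM K))).trans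
      (rad_maximal hKm hKt hmax)

theorem submodular_rad {G : Type u} [Group G] [Finite G] {A L : Subgroup G}
    (hA : Group.IsSolvable A) (h : Submodular A L) : A ≤ radIn L := by
  induction h with
  | refl => exact le_radIn le_rfl Subgroup.le_normalizer hA
  | step _ hKL hmod ih =>
    exact ih.trans (radIn_transfer hKL (rad_modular _ _ _ rfl hmod))

end Radical

theorem stmt15 {G : Type u} [Group G] [Finite G] {A : Subgroup G}
    (hA : IsSolvable A) (h : Submodular A ⊤) :
    A ≤ solvRad G ∧ ∀ B : Subgroup G, IsSolvable B → IsSolvable ↥(A ⊔ B) := by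
  have h1 : A ≤ solvRad G := (submodular_rad hA h).trans
    (le_solvRad (radIn_normal ⊤) (radIn_solvable ⊤))
  refine ⟨h1, fun B hB => ?_⟩
  have hn := (solvRad_spec G).1
  exact solvable_of_le (sup_le_sup_right h1 B) (sup_solvable (solvRad_spec G).2 hB)
end
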